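/- arXiv:2210.12290 — 3 statements merged into one kernel-verified Lean document; each statement's English description precedes it below -/
import Mathlib

section
/- For every natural number n there exists a prime p such that whenever K is a field whose characteristic is either zero or at least p, and K is colored with n colors, there exist nonzero elements x and y of K such that the set {x, y, x*y, x + y} is monochromatic. -/
/-- The set `U` contains all nonempty subset sums of some `D`-tuple of rational numbers. -/
def HasSubsetSums (D : ℕ) (U : Set ℚ) : Prop :=
  ∃ s : Fin D → ℚ, ∀ a : Finset (Fin D), a.Nonempty → ∑ i ∈ a, s i ∈ U

theorem HasSubsetSums.exists_fun {ι : Type*} [Fintype ι] {U : Set ℚ}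
    (h : HasSubsetSums (Fintype.card ι) U) :
    ∃ s : ι → ℚ, ∀ a : Finset ι, a.Nonempty → ∑ i ∈ a, s i ∈ U := by
  obtain ⟨s, hs⟩ := h
  refine ⟨fun i => s (Fintype.equivFin ι i), fun a ha => ?_⟩
  have := hs (a.map (Fintype.equivFin ι).toEmbedding) (ha.map)
  simpa [Finset.sum_map] using this

open Combinatorics in
/-- A form of van der Waerden's theorem in which the common difference is a subset sum and the
number of candidate configurations is bounded in advance. -/
theorem exists_common_difference (I κ : Type) [Finite I] [Finite κ] :
    ∃ (D : ℕ) (L : Type) (_ : Finite L), ∀ U : Set ℚ, HasSubsetSums D U → ∀ v : I → ℚ,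
      ∃ u w : L → ℚ, (∀ l, u l ∈ U) ∧
        ∀ C : ℚ → κ, ∃ l, ∀ i, C (w l + u l * v i) = C (w l) := by
  classical
  obtain ⟨ι, _, hι⟩ := Line.exists_mono_in_high_dimension (Option I) κ
  have hfin : Finite (Line (Option I) ι) :=
    Finite.of_injective Line.idxFun fun _ _ h => Line.ext h
  refine ⟨Fintype.card ι, Line (Option I) ι, hfin, fun U hU v => ?_⟩
  obtain ⟨s, hs⟩ := hU.exists_fun
  let β : (ι → Option I) → ℚ := fun x => ∑ d, s d * (x d).elim 0 v
  refine ⟨fun l => ∑ d with l.idxFun d = none, s d, fun l => β (l none), fun l => ?_, fun C => ?_⟩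
  · obtain ⟨d, hd⟩ := l.proper
    exact hs _ ⟨d, by simpa using hd⟩
  · obtain ⟨l, k, hl⟩ := hι (fun x => C (β x))
    refine ⟨l, fun i => ?_⟩
    have key : β (l none) + (∑ d with l.idxFun d = none, s d) * v i = β (l (some i)) := by
      simp only [β, Finset.sum_filter, Finset.sum_mul, ← Finset.sum_add_distrib]
      refine Finset.sum_congr rfl fun d _ => ?_
      cases h : l.idxFun d <;> simp [h]
    rw [key]
    exact (hl (some i)).trans (hl none).symm

/-- Given sufficiently many subset sums in each `U p`, every coloring `c` admits `u p ∈ U p` such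
that, writing `t i = u 0 * ⋯ * u (i - 1)`, all translations of `f * t i * b` by the quotients
`t j / t i` are invisible to the coloring. -/
theorem exists_translation_invariant (F : Finset ℚ) (κ : Type) [Finite κ] (M : ℕ) :
    ∃ (R : ℕ → ℕ) (Ω : Type) (_ : Finite Ω), ∀ U : ℕ → Set ℚ,
      (∀ p < M, HasSubsetSums (R p) (U p)) →
      ∃ (u : Ω → ℕ → ℚ) (w : Ω → ℚ), (∀ ω, ∀ p < M, u ω p ∈ U p) ∧
        ∀ c : ℚ → ℚ → κ, ∃ ω, ∀ f ∈ F, ∀ j ≤ M, ∀ i < j,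
          c (f * ∏ p ∈ Finset.range i, u ω p)
            (w ω + (∏ p ∈ Finset.range j, u ω p) /
              ((∏ p ∈ Finset.range i, u ω p) * (f * ∏ p ∈ Finset.range i, u ω p))) =
          c (f * ∏ p ∈ Finset.range i, u ω p) (w ω) := by
  classical
  induction M with
  | zero =>
    refine ⟨0, Unit, inferInstance, fun U _ => ⟨0, 0, by simp, fun c => ⟨(), ?_⟩⟩⟩
    intro f _ j hj i hi
    omega
  | succ M ih =>
    obtain ⟨R, Ω, _, hR⟩ := ih
    obtain ⟨D, L, _, hD⟩ := exists_common_difference (F × Fin (M + 1) × Ω)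
      (F × Fin (M + 1) × Ω → κ)
    refine ⟨Function.update R M D, Ω × L, inferInstance, fun U hU => ?_⟩
    obtain ⟨u, w, huU, huw⟩ := hR U fun p hp => by
      simpa [Function.update_of_ne hp.ne] using hU p (by omega)
    let t : Ω → ℕ → ℚ := fun ω i => ∏ p ∈ Finset.range i, u ω p
    obtain ⟨u', w', hu'U, hu'⟩ := hD (U M) (by simpa using hU M (by omega))
      (fun x => t x.2.2 M / (t x.2.2 x.2.1 * (x.1 * t x.2.2 x.2.1)))
    have ht : ∀ (x : Ω × L) (i : ℕ), i ≤ M →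
        ∏ p ∈ Finset.range i, Function.update (u x.1) M (u' x.2) p = t x.1 i := by
      intro x i hi
      refine Finset.prod_congr rfl fun p hp => ?_
      rw [Function.update_of_ne]
      have := Finset.mem_range.1 hp
      omega
    refine ⟨fun x => Function.update (u x.1) M (u' x.2), fun x => w' x.2 + w x.1, ?_, ?_⟩
    · intro x p hp
      rcases eq_or_ne p M with rfl | hpM
      · simpa using hu'U x.2
      · simpa [Function.update_of_ne hpM] using huU x.1 p (by omega)
    · intro c
      obtain ⟨l, hl⟩ := hu' fun b x => c (x.1 * t x.2.2 x.2.1) (b + w x.2.2)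
      obtain ⟨ω, hω⟩ := huw fun z b => c z (w' l + b)
      refine ⟨(ω, l), fun f hf j hj i hij => ?_⟩
      rw [ht _ i (by omega)]
      rcases Nat.lt_or_ge M j with hMj | hjM
      · obtain rfl : j = M + 1 := by omega
        rw [Finset.prod_range_succ, ht _ M le_rfl]
        simp only [Function.update_self]
        have := congrFun (hl (⟨f, hf⟩, ⟨i, by omega⟩, ω)) (⟨f, hf⟩, ⟨i, by omega⟩, ω)
        simp only at this
        rw [← this]
        congr 1
        ring
      · rw [ht _ j hjM, add_assoc]
        exact hω f hf j hjM i hij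

/-- There is a sequence of levels `τ` such that any labelling of an initial segment by a level and
an element of `F` has two equal labels whose level is the largest level attained between them. -/
theorem exists_level_sequence {β : Type*} (F : Finset β) (k : ℕ) :
    ∃ (N : ℕ) (τ : ℕ → ℕ), 0 < N ∧ (∀ p, τ p < k ∨ k = 0) ∧
      ∀ lab : ℕ → ℕ × β, (∀ i < N, (lab i).1 < k ∧ (lab i).2 ∈ F) →
        ∃ i j, i < j ∧ j < N ∧ lab i = lab j ∧ (∀ p ∈ Finset.Ico i j, τ p ≤ (lab i).1) ∧
          ∃ p ∈ Finset.Ico i j, τ p = (lab i).1 := by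
  classical
  induction k with
  | zero =>
    exact ⟨1, 0, one_pos, fun _ => Or.inr rfl, fun lab h => absurd (h 0 one_pos).1 (by simp)⟩
  | succ k ih =>
    obtain ⟨N, τ, hN, hτ, h⟩ := ih
    let τ' : ℕ → ℕ := fun p => if N ∣ p + 1 ∨ k = 0 then k else τ (p % N)
    have hτ' : ∀ p, τ' p ≤ k := by
      intro p
      by_cases hp : N ∣ p + 1 ∨ k = 0
      · simp [τ', hp]
      · simp only [τ', hp, if_false]
        have := hτ (p % N)
        omega
    refine ⟨(F.card + 1) * N, τ', by positivity,
      fun p => Or.inl (Nat.lt_succ_of_le (hτ' p)), fun lab hlab => ?_⟩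
    by_cases hblock : ∃ a < F.card + 1, ∀ i < N, (lab (a * N + i)).1 < k
    · obtain ⟨a, ha, hak⟩ := hblock
      have hlt : ∀ i < N, a * N + i < (F.card + 1) * N := fun i hi => by nlinarith
      have hk0 : k ≠ 0 := fun h0 => by simpa [h0] using hak 0 hN
      obtain ⟨i, j, hij, hjN, heq, hle, p, hp, hpe⟩ := h (fun i => lab (a * N + i))
        fun i hi => ⟨hak i hi, (hlab _ (hlt i hi)).2⟩
      have hτp : ∀ p, p + 1 < N → τ' (a * N + p) = τ p := by
        intro p hp
        have h1 : ¬ N ∣ a * N + p + 1 := by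
          rw [add_assoc, Nat.dvd_add_right (Dvd.intro_left a rfl)]
          exact Nat.not_dvd_of_pos_of_lt (by omega) hp
        have h2 : (a * N + p) % N = p := by
          rw [Nat.add_comm, Nat.add_mul_mod_self_right, Nat.mod_eq_of_lt (by omega)]
        simp [τ', h1, hk0, h2]
      refine ⟨a * N + i, a * N + j, by omega, hlt j hjN, heq, fun q hq => ?_,
        a * N + p, ?_, ?_⟩
      · obtain ⟨q, rfl⟩ : ∃ q', q = a * N + q' := ⟨q - a * N, by
          have := Finset.mem_Ico.1 hq; omega⟩
        have hq := Finset.mem_Ico.1 hq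
        rw [hτp q (by omega)]
        exact hle q (Finset.mem_Ico.2 (by omega))
      · have := Finset.mem_Ico.1 hp
        exact Finset.mem_Ico.2 (by omega)
      · have := Finset.mem_Ico.1 hp
        rw [hτp p (by omega), hpe]
    · push Not at hblock
      choose! i hiN hik using hblock
      have hlt : ∀ a < F.card + 1, a * N + i a < (F.card + 1) * N := fun a ha => by
        have := hiN a ha; nlinarith
      have hlab1 : ∀ a < F.card + 1, (lab (a * N + i a)).1 = k := fun a ha => by
        have h1 := (hlab _ (hlt a ha)).1
        have h2 := hik a ha
        omega
      obtain ⟨a, ha, b, hb, hab, heq⟩ := Finset.exists_ne_map_eq_of_card_lt_of_maps_to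
        (s := Finset.range (F.card + 1)) (t := F) (by simp)
        (f := fun a => (lab (a * N + i a)).2)
        (fun a ha => (hlab _ (hlt a (Finset.mem_range.1 ha))).2)
      wlog hlt' : a < b generalizing a b
      · exact this b hb a ha hab.symm heq.symm (by omega)
      rw [Finset.mem_range] at ha hb
      have hmul : (a + 1) * N ≤ b * N := Nat.mul_le_mul_right N hlt'
      have hia := hiN a ha
      have haN : (a + 1) * N = a * N + N := by ring
      refine ⟨a * N + i a, b * N + i b, by omega, hlt b hb,
        Prod.ext ((hlab1 a ha).trans (hlab1 b hb).symm) heq, fun p _ => ?_,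
        (a + 1) * N - 1, Finset.mem_Ico.2 (by omega), ?_⟩
      · rw [hlab1 a ha]
        exact hτ' p
      · have : N ∣ (a + 1) * N - 1 + 1 := by
          rw [Nat.sub_add_cancel (by omega)]
          exact Dvd.intro_left _ rfl
        simp [τ', this, hlab1 a ha]

attribute [local instance] Ultrafilter.mul Ultrafilter.add
attribute [local instance] Ultrafilter.semigroup Ultrafilter.addSemigroup

open Filter

/-- Every closed left ideal of a compact right topological semigroup contains an idempotent which
is fixed under left multiplication by a prescribed idempotent `g`. -/
theorem exists_idempotent_mul_eq_self {S : Type*} [Semigroup S] [TopologicalSpace S]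
    [CompactSpace S] [T2Space S] (hS : ∀ r : S, Continuous (· * r)) {J : Set S}
    (hJ : IsClosed J) (hJne : J.Nonempty) (hJmul : ∀ q, ∀ p ∈ J, q * p ∈ J) {g : S}
    (hg : g * g = g) : ∃ e ∈ J, e * e = e ∧ g * e = e := by
  let T : Set (Set S) := {N | IsClosed N ∧ N.Nonempty ∧ (∀ q, ∀ p ∈ N, q * p ∈ N)}
  obtain ⟨L, hLJ, hL⟩ : ∃ L, L ⊆ J ∧ Minimal (· ∈ T) L := by
    refine zorn_superset_nonempty T (fun c hcT hc hcne => ?_) J ⟨hJ, hJne, hJmul⟩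
    refine ⟨⋂₀ c, ⟨isClosed_sInter fun t ht => (hcT ht).1, ?_, fun q p hp t ht =>
      (hcT ht).2.2 q p (hp t ht)⟩, fun s hs => Set.sInter_subset_of_mem hs⟩
    have := hcne.coe_sort
    rw [Set.sInter_eq_iInter]
    exact IsCompact.nonempty_iInter_of_directed_nonempty_isCompact_isClosed _
      (DirectedOn.directed_val (IsChain.directedOn hc.symm)) (fun i => (hcT i.2).2.1)
      (fun i => (hcT i.2).1.isCompact) (fun i => (hcT i.2).1)
  obtain ⟨hLc, hLne, hLmul⟩ := hL.prop
  obtain ⟨e₀, he₀, he₀e₀⟩ := exists_idempotent_in_compact_subsemigroup hS L hLne hLc.isCompact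
    fun x _ y hy => hLmul x y hy
  have hx : g * e₀ ∈ L := hLmul g e₀ he₀
  have hLx : (· * (g * e₀)) '' L = L := by
    refine hL.eq_of_subset ⟨(hS _).isClosedMap _ hLc, hLne.image _, ?_⟩ ?_
    · rintro q _ ⟨p, hp, rfl⟩
      exact ⟨q * p, hLmul q p hp, mul_assoc _ _ _⟩
    · rintro _ ⟨p, -, rfl⟩
      exact hLmul p _ hx
  obtain ⟨y, hy, hyx⟩ : e₀ ∈ (· * (g * e₀)) '' L := hLx.symm ▸ he₀
  have hyx : y * (g * e₀) = e₀ := hyx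
  refine ⟨g * e₀ * (e₀ * y), hLJ (hLmul _ _ (hLmul _ _ hy)), ?_, ?_⟩
  · calc g * e₀ * (e₀ * y) * (g * e₀ * (e₀ * y))
        = g * e₀ * e₀ * (y * (g * e₀)) * (e₀ * y) := by simp only [mul_assoc]
      _ = g * (e₀ * e₀ * e₀) * (e₀ * y) := by rw [hyx]; simp only [mul_assoc]
      _ = g * e₀ * (e₀ * y) := by rw [he₀e₀, he₀e₀]
  · simp only [← mul_assoc, hg]

/-- The ultrafilters on `ℚˣ` all of whose members contain arbitrarily large sets of subset sums. -/
def subsetSumUltrafilters : Set (Ultrafilter ℚˣ) :=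
  {q | ∀ E ∈ q, ∀ D, HasSubsetSums D ((↑) '' E : Set ℚ)}

theorem isClosed_subsetSumUltrafilters : IsClosed subsetSumUltrafilters := by
  have : subsetSumUltrafilters = ⋂ (E : Set ℚˣ) (_ : ¬ ∀ D, HasSubsetSums D ((↑) '' E : Set ℚ)),
      {q : Ultrafilter ℚˣ | Eᶜ ∈ q} := by
    ext q
    simp only [subsetSumUltrafilters, Set.mem_iInter, Set.mem_ofPred_eq,
      Ultrafilter.compl_mem_iff_notMem]
    exact forall_congr' fun E => not_imp_not.symm
  rw [this]
  exact isClosed_iInter fun E => isClosed_iInter fun _ => ultrafilter_isClosed_basic _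

theorem mul_mem_subsetSumUltrafilters_left (q : Ultrafilter ℚˣ) {p : Ultrafilter ℚˣ}
    (hp : p ∈ subsetSumUltrafilters) : q * p ∈ subsetSumUltrafilters := by
  intro E hE D
  have hE : ∀ᶠ a in q, ∀ᶠ b in p, a * b ∈ E := hE
  obtain ⟨a, ha⟩ := hE.exists
  obtain ⟨s, hs⟩ := hp _ ha D
  refine ⟨fun i => a * s i, fun t ht => ?_⟩
  obtain ⟨b, hb, hbs⟩ := hs t ht
  exact ⟨a * b, hb, by rw [Units.val_mul, hbs, Finset.mul_sum]⟩

theorem mul_mem_subsetSumUltrafilters_right {q : Ultrafilter ℚˣ}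
    (hq : q ∈ subsetSumUltrafilters) (p : Ultrafilter ℚˣ) : q * p ∈ subsetSumUltrafilters := by
  intro E hE D
  have hE : ∀ᶠ a in q, ∀ᶠ b in p, a * b ∈ E := hE
  obtain ⟨s, hs⟩ := hq _ hE D
  choose! y hy hys using hs
  have : ∀ᶠ b in p, ∀ t : Finset (Fin D), t.Nonempty → y t * b ∈ E := by
    refine eventually_all.2 fun t => ?_
    by_cases ht : t.Nonempty
    · filter_upwards [hy t ht] with b hb _ using hb
    · exact Eventually.of_forall fun b h => absurd h ht
  obtain ⟨b, hb⟩ := this.exists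
  exact ⟨fun i => s i * b, fun t ht => ⟨y t * b, hb t ht, by
    rw [Units.val_mul, hys t ht, Finset.sum_mul]⟩⟩

theorem subsetSumUltrafilters_nonempty : subsetSumUltrafilters.Nonempty := by
  obtain ⟨U, hU, hUpos⟩ := Hindman.exists_idempotent_ultrafilter_le_FS (Stream'.const 1 : Stream' ℕ)
  have hpos : ∀ (a : Stream' ℕ) (m : ℕ), Hindman.FS a m → a = Stream'.const 1 → 0 < m := by
    intro a m h
    induction h with
    | head' a => rintro rfl; exact one_pos
    | tail' a m _ ih => rintro rfl; exact ih rfl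
    | cons' a m _ ih => rintro rfl; exact Nat.add_pos_left one_pos _
  let f : ℕ → ℚˣ := fun m => if h : (m : ℚ) = 0 then 1 else Units.mk0 m h
  refine ⟨U.map f, fun E hE D => ?_⟩
  have hE : ∀ᶠ m in U, f m ∈ E := hE
  obtain ⟨b, hb⟩ := Hindman.exists_FS_of_large U hU _ (hE.and hUpos)
  refine ⟨fun i => b.get i, fun a ha => ?_⟩
  have hmem := Hindman.FS.finsetSum b (a.map Fin.valEmbedding) (ha.map)
  rw [Finset.sum_map] at hmem
  obtain ⟨h1, h2⟩ := hb hmem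
  have h3 := (hpos _ _ h2 rfl).ne'
  refine ⟨_, h1, ?_⟩
  have h4 : ((∑ i ∈ a, b.get (Fin.valEmbedding i) : ℕ) : ℚ) ≠ 0 := Nat.cast_ne_zero.2 h3
  simp only [f, dif_neg h4, Units.val_mk0]
  push_cast
  rfl

/-- Given a chain of idempotents `e 0, …, e (k - 1)` with `e σ * e τ = e τ` for `σ ≤ τ` and large
sets `C τ`, there are finite sets `U p`, rich in subset sums, such that the product of elements of
distinct `U p` lies in the set `C τ` of the highest level `τ` involved. -/
theorem exists_finset_prod_mem {k : ℕ} {e : ℕ → Ultrafilter ℚˣ} {C : ℕ → Set ℚˣ}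
    (he : ∀ τ < k, ∀ σ ≤ τ, e σ * e τ = e τ) (hC : ∀ τ < k, C τ ∈ e τ)
    (hI : ∀ τ < k, e τ ∈ subsetSumUltrafilters) (τ R : ℕ → ℕ) (P : Finset ℕ)
    (hP : ∀ p ∈ P, τ p < k) :
    ∃ U : ℕ → Finset ℚˣ, (∀ p ∈ P, HasSubsetSums (R p) ((↑) '' (U p : Set ℚˣ))) ∧
      ∀ S ⊆ P, ∀ u : ℕ → ℚˣ, (∀ p ∈ S, u p ∈ U p) → ∀ q ∈ S, (∀ p ∈ S, τ p ≤ τ q) →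
        ∏ p ∈ S, u p ∈ C (τ q) := by
  classical
  let good : ℕ → Set ℚˣ := fun σ => {π | ∀ ρ, σ ≤ ρ → ρ < k → ∀ᶠ x in e ρ, π * x ∈ C ρ}
  have hgood : ∀ σ < k, ∀ π ∈ good σ, ∀ᶠ u in e σ, π * u ∈ C σ ∧ π * u ∈ good σ := by
    intro σ hσ π hπ
    refine (hπ σ le_rfl hσ).and ?_
    have : ∀ᶠ u in e σ, ∀ ρ : Fin k, σ ≤ ρ → ∀ᶠ x in e ρ, π * (u * x) ∈ C ρ := by
      refine eventually_all.2 fun ρ => ?_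
      by_cases hρ : σ ≤ ρ
      · have h := hπ ρ hρ ρ.2
        rw [← he ρ ρ.2 σ hρ, Ultrafilter.eventually_mul] at h
        filter_upwards [h] with u hu _ using hu
      · exact Eventually.of_forall fun u h => absurd h hρ
    filter_upwards [this] with u hu ρ hσρ hρ
    simpa only [mul_assoc] using hu ⟨ρ, hρ⟩ hσρ
  suffices H : ∃ (U : ℕ → Finset ℚˣ) (Q : Finset ℚˣ),
      (∀ p ∈ P, HasSubsetSums (R p) ((↑) '' (U p : Set ℚˣ))) ∧
      (∀ σ, (∀ p ∈ P, τ p ≤ σ) → ∀ π ∈ Q, π ∈ good σ) ∧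
      ∀ S ⊆ P, ∀ u : ℕ → ℚˣ, (∀ p ∈ S, u p ∈ U p) → ∏ p ∈ S, u p ∈ Q ∧
        ∀ q ∈ S, (∀ p ∈ S, τ p ≤ τ q) → ∏ p ∈ S, u p ∈ C (τ q) by
    obtain ⟨U, _, hU, _, h⟩ := H
    exact ⟨U, hU, fun S hS u hu => (h S hS u hu).2⟩
  induction P using Finset.induction_on_max_value τ with
  | empty =>
    refine ⟨fun _ => ∅, {1}, by simp, ?_, ?_⟩
    · intro σ _ π hπ ρ _ hρ
      rw [Finset.mem_singleton.1 hπ]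
      filter_upwards [hC ρ hρ] with x hx
      simpa using hx
    · intro S hS u _
      rw [Finset.subset_empty.1 hS]
      simp
  | insert a P haP hmax ih =>
    obtain ⟨U, Q, hU, hQ, h⟩ := ih fun p hp => hP p (Finset.mem_insert_of_mem hp)
    have ha : τ a < k := hP a (Finset.mem_insert_self a P)
    have hE : ∀ᶠ u in e (τ a), ∀ π ∈ Q, π * u ∈ C (τ a) ∧ π * u ∈ good (τ a) :=
      (eventually_all_finset Q).2 fun π hπ => hgood _ ha π (hQ _ hmax π hπ)
    obtain ⟨s, hs⟩ := hI _ ha _ hE (R a)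
    choose! y hyE hys using hs
    let V : Finset ℚˣ := (Finset.univ.filter Finset.Nonempty).image y
    have hV : ∀ u ∈ V, ∀ π ∈ Q, π * u ∈ C (τ a) ∧ π * u ∈ good (τ a) := by
      intro u hu
      obtain ⟨t, ht, rfl⟩ := Finset.mem_image.1 hu
      exact hyE t (Finset.mem_filter.1 ht).2
    refine ⟨Function.update U a V, Q ∪ Finset.image₂ (· * ·) Q V, ?_, ?_, ?_⟩
    · intro p hp
      rcases eq_or_ne p a with rfl | hpa
      · refine ⟨s, fun t ht => ⟨y t, ?_, hys t ht⟩⟩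
        simpa [V] using ⟨t, ht, rfl⟩
      · rw [Function.update_of_ne hpa]
        exact hU p (Finset.mem_of_mem_insert_of_ne hp hpa)
    · intro σ hσ π hπ
      rcases Finset.mem_union.1 hπ with hπ | hπ
      · exact hQ σ (fun p hp => hσ p (Finset.mem_insert_of_mem hp)) π hπ
      · obtain ⟨π', hπ', u, hu, rfl⟩ := Finset.mem_image₂.1 hπ
        exact fun ρ hρ => (hV u hu π' hπ').2 ρ ((hσ a (Finset.mem_insert_self a P)).trans hρ)
    · intro S hS u hu
      have hne : ∀ p ∈ S.erase a, u p ∈ U p := fun p hp => by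
        simpa [Function.update_of_ne (Finset.ne_of_mem_erase hp)] using
          hu p (Finset.mem_of_mem_erase hp)
      have hsub : S.erase a ⊆ P := fun p hp => Finset.mem_of_mem_insert_of_ne
        (hS (Finset.mem_of_mem_erase hp)) (Finset.ne_of_mem_erase hp)
      have hprod := h _ hsub u hne
      by_cases haS : a ∈ S
      · have hua : u a ∈ V := by simpa using hu a haS
        rw [← Finset.prod_erase_mul S u haS]
        refine ⟨Finset.mem_union_right _ (Finset.mem_image₂_of_mem hprod.1 hua), ?_⟩
        intro q hq hqmax
        have hqa : τ q = τ a := by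
          refine le_antisymm ?_ (hqmax a haS)
          rcases Finset.mem_insert.1 (hS hq) with rfl | hqP
          · exact le_rfl
          · exact hmax q hqP
        rw [hqa]
        exact (hV _ hua _ hprod.1).1
      · rw [Finset.erase_eq_of_notMem haS] at hprod
        exact ⟨Finset.mem_union_left _ hprod.1, hprod.2⟩

/-- If no quadruple `{x, y, x * y, x + y}` is monochromatic, then finitely many dilates cannot
cover `ℚˣ` by color classes carried by a chain of idempotents. -/
theorem exists_forall_color_ne {r k : ℕ} {χ : ℚ → Fin r}
    (hχ : ∀ x y : ℚ, x ≠ 0 → y ≠ 0 → χ y = χ x → χ (x * y) = χ x → χ (x + y) ≠ χ x)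
    {e : ℕ → Ultrafilter ℚˣ} {A : ℕ → Fin r}
    (he : ∀ τ < k, ∀ σ ≤ τ, e σ * e τ = e τ) (hA : ∀ τ < k, ∀ᶠ x in e τ, χ (x : ℚˣ) = A τ)
    (hI : ∀ τ < k, e τ ∈ subsetSumUltrafilters) (F : Finset ℚˣ) :
    ∃ b : ℚˣ, ∀ f ∈ F, ∀ τ < k, χ (f * b : ℚˣ) ≠ A τ := by
  classical
  by_contra! hcover
  obtain ⟨f₀, hf₀, τ₀, hτ₀, -⟩ := hcover 1
  obtain ⟨N, τ, hN, hτ, hlab⟩ := exists_level_sequence F k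
  have hτ : ∀ p, τ p < k := fun p => (hτ p).resolve_right (by omega)
  obtain ⟨R, Ω, _, hR⟩ := exists_translation_invariant (F.image (↑)) (Fin r × Prop) N
  obtain ⟨U, hU, hUC⟩ := exists_finset_prod_mem (C := fun τ => {x : ℚˣ | χ x = A τ}) he hA hI τ R
    (Finset.range N) fun p _ => hτ p
  obtain ⟨u, w, hu, huw⟩ := hR (fun p => (↑) '' (U p : Set ℚˣ)) fun p hp =>
    hU p (Finset.mem_range.2 hp)
  obtain ⟨ω, hω⟩ := huw fun z b => (χ (z * b), b = 0)
  have hv : ∀ p, ∃ v : ℚˣ, p < N → v ∈ U p ∧ (v : ℚ) = u ω p := fun p => by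
    by_cases hp : p < N
    · obtain ⟨v, hv⟩ := hu ω p hp
      exact ⟨v, fun _ => hv⟩
    · exact ⟨1, fun h => absurd h hp⟩
  choose v hv using hv
  let t : ℕ → ℚˣ := fun i => ∏ p ∈ Finset.range i, v p
  have ht : ∀ i ≤ N, ∏ p ∈ Finset.range i, u ω p = t i := fun i hi => by
    rw [Units.coe_prod]
    exact Finset.prod_congr rfl fun p hp =>
      (hv p ((Finset.mem_range.1 hp).trans_le hi)).2.symm
  have hinv : ∀ f ∈ F, ∀ j ≤ N, ∀ i < j,
      χ (f * t i * (w ω + t j / (t i * (f * t i)))) = χ (f * t i * w ω) ∧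
        (w ω + t j / (t i * (f * t i)) = 0 ↔ w ω = 0) := fun f hf j hj i hij => by
    have := hω f (Finset.mem_image_of_mem _ hf) j hj i hij
    rw [ht i (by omega), ht j hj] at this
    exact ⟨congrArg Prod.fst this, iff_of_eq (congrArg Prod.snd this)⟩
  have hw : w ω ≠ 0 := fun h0 => by
    have := (hinv f₀ hf₀ N le_rfl 0 hN).2.2 h0
    rw [h0, zero_add] at this
    exact absurd this (div_ne_zero (Units.ne_zero _)
      (mul_ne_zero (Units.ne_zero _) (mul_ne_zero (Units.ne_zero _) (Units.ne_zero _))))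
  choose f hfF σ hσ hfσ using fun i => hcover (t i * Units.mk0 _ hw)
  obtain ⟨i, j, hij, hjN, heq, hle, p, hp, hpσ⟩ := hlab (fun i => (σ i, f i)) fun i _ =>
    ⟨hσ i, hfF i⟩
  obtain ⟨hσij, hfij⟩ := Prod.ext_iff.1 heq
  simp only at hσij hfij hle hpσ
  have htij : t i * ∏ p ∈ Finset.Ico i j, v p = t j := Finset.prod_range_mul_prod_Ico v hij.le
  have hy : χ (∏ p ∈ Finset.Ico i j, v p : ℚˣ) = A (σ i) := by
    rw [← hpσ]
    refine hUC _ (fun q hq => ?_) v (fun q hq => (hv q ?_).1) p hp fun q hq => hpσ ▸ hle q hq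
    all_goals
      have := Finset.mem_Ico.1 hq
      first | exact Finset.mem_range.2 (by omega) | omega
  have hi := hfσ i
  have hj := hfσ j
  rw [← hfij, ← hσij] at hj
  have hsum := (hinv _ (hfF i) j (by omega) i hij).1
  rw [← htij] at hj hsum
  set y := ∏ p ∈ Finset.Ico i j, v p
  refine hχ (f i * (t i * Units.mk0 _ hw) : ℚˣ) y (Units.ne_zero _) (Units.ne_zero _)
    (hy.trans hi.symm) ?_ ?_
  · rw [hi, ← hj]
    congr 1
    push_cast
    ring
  · refine Eq.trans ?_ (hsum.trans ?_)
    · congr 1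
      have := (t i).ne_zero
      have := (f i).ne_zero
      push_cast
      simp only [Units.val_mk0]
      field_simp
    · congr 1
      push_cast
      simp only [Units.val_mk0]
      ring

theorem Ultrafilter.exists_eventually_eq {α κ : Type*} [Finite κ] (q : Ultrafilter α) (c : α → κ) :
    ∃ a, ∀ᶠ x in q, c x = a := by
  obtain ⟨a, ha⟩ := (q.map c).eq_pure_of_finite
  refine ⟨a, ?_⟩
  have : {a} ∈ q.map c := by rw [ha]; exact rfl
  exact this

/-- If no quadruple `{x, y, x * y, x + y}` is monochromatic, then there are arbitrarily long chains
of idempotents carried by distinct color classes. -/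
theorem exists_idempotent_chain {r : ℕ} {χ : ℚ → Fin r}
    (hχ : ∀ x y : ℚ, x ≠ 0 → y ≠ 0 → χ y = χ x → χ (x * y) = χ x → χ (x + y) ≠ χ x) (k : ℕ) :
    ∃ (e : ℕ → Ultrafilter ℚˣ) (A : ℕ → Fin r), (∀ τ < k, ∀ σ < τ, A σ ≠ A τ) ∧
      (∀ τ < k, ∀ σ ≤ τ, e σ * e τ = e τ) ∧ (∀ τ < k, ∀ᶠ x in e τ, χ (x : ℚˣ) = A τ) ∧
      ∀ τ < k, e τ ∈ subsetSumUltrafilters := by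
  classical
  induction k with
  | zero => exact ⟨fun _ => pure 1, fun _ => χ 0, by simp⟩
  | succ k ih =>
    obtain ⟨e, A, hAne, he, hA, hI⟩ := ih
    let J : Set (Ultrafilter ℚˣ) :=
      {q | ∀ z : ℚˣ, ∀ᶠ b in q, ∀ τ < k, χ (z * b : ℚˣ) ≠ A τ}
    have hJ : IsClosed J := by
      have : J = ⋂ z : ℚˣ, {q : Ultrafilter ℚˣ | {b | ∀ τ < k, χ (z * b : ℚˣ) ≠ A τ} ∈ q} := by
        ext q
        simp only [Set.mem_iInter]
        exact Iff.rfl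
      rw [this]
      exact isClosed_iInter fun z => ultrafilter_isClosed_basic _
    have hJmul : ∀ q, ∀ p ∈ J, q * p ∈ J := fun q p hp z =>
      (Ultrafilter.eventually_mul q p _).2 <| Eventually.of_forall fun a => by
        simpa only [mul_assoc] using hp (z * a)
    obtain ⟨p, hp⟩ : J.Nonempty := by
      obtain ⟨p, hp⟩ := Ultrafilter.exists_ultrafilter_of_finite_inter_nonempty
        ((fun z : ℚˣ => {b : ℚˣ | ∀ τ < k, χ (z * b : ℚˣ) ≠ A τ}) '' Set.univ) fun T hT => by
          obtain ⟨F, -, rfl⟩ := Finset.subset_set_image_iff.1 hT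
          obtain ⟨b, hb⟩ := exists_forall_color_ne hχ he hA hI F
          refine ⟨b, fun B hB => ?_⟩
          obtain ⟨f, hf, rfl⟩ := Finset.mem_image.1 hB
          exact hb f hf
      exact ⟨p, fun z => hp ⟨z, trivial, rfl⟩⟩
    obtain ⟨q, hq⟩ := subsetSumUltrafilters_nonempty
    obtain ⟨g, hg, hge⟩ : ∃ g : Ultrafilter ℚˣ, g * g = g ∧ ∀ σ < k, e σ * g = g := by
      rcases k with - | k
      · obtain ⟨g, hg⟩ := exists_idempotent_of_compact_t2_of_continuous_mul_left
          (M := Ultrafilter ℚˣ) Ultrafilter.continuous_mul_left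
        exact ⟨g, hg, by simp⟩
      · exact ⟨e k, he k k.lt_succ_self k le_rfl, fun σ hσ =>
          he k k.lt_succ_self σ (Nat.le_of_lt_succ hσ)⟩
    obtain ⟨e', ⟨he'J, he'I⟩, he', hge'⟩ := exists_idempotent_mul_eq_self
      Ultrafilter.continuous_mul_left (hJ.inter isClosed_subsetSumUltrafilters)
      ⟨q * p, hJmul q p hp, mul_mem_subsetSumUltrafilters_right hq p⟩
      (fun q p hp => ⟨hJmul q p hp.1, mul_mem_subsetSumUltrafilters_left q hp.2⟩) hg
    obtain ⟨a, ha⟩ := e'.exists_eventually_eq fun x => χ (x : ℚˣ)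
    have hne : ∀ σ < k, A σ ≠ a := fun σ hσ h => by
      obtain ⟨x, hx, hxa⟩ := ((he'J 1).and ha).exists
      exact hx σ hσ (by rw [one_mul, hxa, h])
    have hee' : ∀ σ < k, e σ * e' = e' := fun σ hσ => by
      rw [← hge', ← mul_assoc, hge σ hσ]
    refine ⟨Function.update e k e', Function.update A k a, ?_, ?_, ?_, ?_⟩
    all_goals
      intro τ hτ
      rcases Nat.lt_succ_iff_lt_or_eq.1 hτ with hτ | rfl
    · intro σ hσ
      rw [Function.update_of_ne hτ.ne, Function.update_of_ne (hσ.trans hτ).ne]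
      exact hAne τ hτ σ hσ
    · intro σ hσ
      rw [Function.update_self, Function.update_of_ne hσ.ne]
      exact hne σ hσ
    · intro σ hσ
      rw [Function.update_of_ne hτ.ne, Function.update_of_ne (hσ.trans_lt hτ).ne]
      exact he τ hτ σ hσ
    · intro σ hσ
      rcases hσ.lt_or_eq with hσ | rfl
      · rw [Function.update_self, Function.update_of_ne hσ.ne]
        exact hee' σ hσ
      · rwa [Function.update_self]
    · simpa only [Function.update_of_ne hτ.ne] using hA τ hτ
    · simpa only [Function.update_self] using ha
    · simpa only [Function.update_of_ne hτ.ne] using hI τ hτ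
    · simpa only [Function.update_self] using he'I

/-- Every finite coloring of the rational numbers admits nonzero `x` and `y` such that
`{x, y, x * y, x + y}` is monochromatic. -/
theorem exists_monochromatic_quadruple_rat {r : ℕ} (χ : ℚ → Fin r) :
    ∃ x y : ℚ, x ≠ 0 ∧ y ≠ 0 ∧ χ y = χ x ∧ χ (x * y) = χ x ∧ χ (x + y) = χ x := by
  by_contra! hχ
  obtain ⟨_, A, hA, -⟩ := exists_idempotent_chain hχ (r + 1)
  have hinj : Function.Injective fun i : Fin (r + 1) => A i := fun i j hij => by
    by_contra hne
    rcases lt_or_gt_of_ne hne with h | h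
    · exact hA j j.2 i h hij
    · exact hA i i.2 j h hij.symm
  simpa using Fintype.card_le_of_injective _ hinj

theorem natCast_ne_zero_of_lt_ringChar {K : Type*} [Field K] {p d : ℕ}
    (hK : ringChar K = 0 ∨ p ≤ ringChar K) (hd : d ≠ 0) (hdp : d < p) : (d : K) ≠ 0 := by
  intro h
  have hdvd := ringChar.dvd h
  rcases hK with h0 | h0
  · rw [h0, zero_dvd_iff] at hdvd
    exact hd hdvd
  · exact absurd (Nat.le_of_dvd (Nat.pos_of_ne_zero hd) hdvd) (by omega)

/-- For every `n` there exists a prime `p` such that whenever `K` is a field whose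
characteristic is zero or at least `p`, and `K` is colored with `n` colors, there exist
nonzero `x y : K` with `{x, y, x*y, x+y}` monochromatic. -/
theorem hindman_quadruple_large_char (n : ℕ) :
    ∃ p : ℕ, p.Prime ∧
      ∀ (K : Type) [Field K], (ringChar K = 0 ∨ p ≤ ringChar K) →
        ∀ c : K → Fin n,
          ∃ x y : K, x ≠ 0 ∧ y ≠ 0 ∧ c y = c x ∧ c (x * y) = c x ∧ c (x + y) = c x := by
  by_contra! H
  choose p hp hle using Nat.exists_infinite_primes
  choose K _ hK c hc using fun m => H (p m) (hle m)
  choose χ hχ using fun q : ℚ => (hyperfilter ℕ).exists_eventually_eq fun m => c m (q : K m)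
  obtain ⟨x, y, hx, hy, hxy, hmul, hadd⟩ := exists_monochromatic_quadruple_rat χ
  have hlarge : ∀ d : ℕ, d ≠ 0 → ∀ᶠ m in hyperfilter ℕ, (d : K m) ≠ 0 := fun d hd => by
    have : ∀ᶠ m in hyperfilter ℕ, d < m := by
      refine Filter.Eventually.filter_mono ?_ (eventually_gt_atTop d)
      exact Nat.hyperfilter_le_atTop
    filter_upwards [this] with m hm
    exact natCast_ne_zero_of_lt_ringChar (hK m) hd (hm.trans_le (hp m))
  obtain ⟨m, hcx, hcy, hcxy, hcadd, hdx, hdy, hnx, hny⟩ := ((hχ x).and ((hχ y).and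
    ((hχ (x * y)).and ((hχ (x + y)).and ((hlarge _ x.den_ne_zero).and ((hlarge _ y.den_ne_zero).and
    ((hlarge _ (Int.natAbs_ne_zero.2 (Rat.num_ne_zero.2 hx))).and
      (hlarge _ (Int.natAbs_ne_zero.2 (Rat.num_ne_zero.2 hy)))))))))).exists
  have hcast : ∀ q : ℚ, (q.den : K m) ≠ 0 → (q.num.natAbs : K m) ≠ 0 → (q : K m) ≠ 0 := by
    intro q hd hn
    rw [Rat.cast_def]
    refine div_ne_zero (fun h => hn ?_) hd
    rcases Int.natAbs_eq q.num with h' | h' <;> rw [h'] at h <;> simpa using h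
  rw [Rat.cast_mul_of_ne_zero hdx hdy] at hcxy
  rw [Rat.cast_add_of_ne_zero hdx hdy] at hcadd
  exact hc m x y (hcast x hdx hnx) (hcast y hdy hny) (by rw [hcx, hcy, hxy])
    (by rw [hcx, hcxy, hmul]) (by rw [hcx, hcadd, hadd])
end

section
/- For every natural number n there exists a natural number p₀ such that for every prime p with p > p₀, every coloring of the finite field ℤ/pℤ with n colors admits nonzero elements x and y with the set {x, y, x*y, x + y} monochromatic. -/
open Finset

/-- Additive part, via Hales–Jewett: for any adversarial table `u` of sequences, every `z` has a
shift `z + off s` and factors `y s i` (sums drawn from `u` according to the current color) such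
that adding a multiple in `Q` of a product of consecutive factors preserves the color. -/
theorem exists_shifts_of_coloring {K κ : Type} [Field K] [Finite κ] (χ : K → κ) (Q : Finset K)
    (m : ℕ) : ∃ (S : Type) (_ : Finite S) (D : ℕ), ∀ u : ℕ → κ → ℕ → K,
      (∀ i t, ∀ σ ⊆ range D, σ.Nonempty → ∑ l ∈ σ, u i t l ≠ 0) →
      ∃ (off : S → K) (y : S → ℕ → K), ∀ z, ∃ s,
        (∀ i < m, ∃ σ ⊆ range D, σ.Nonempty ∧
          y s i = ∑ l ∈ σ, u i (χ ((z + off s) * ∏ l ∈ range i, y s l)) l) ∧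
        ∀ i j, i < j → j ≤ m → ∀ q ∈ Q,
          χ ((z + off s) * ∏ l ∈ range i, y s l + q * ∏ l ∈ Ico i j, y s l) =
            χ ((z + off s) * ∏ l ∈ range i, y s l) := by
  classical
  induction m with
  | zero =>
    refine ⟨Unit, inferInstance, 0, fun u _ => ⟨fun _ => 0, fun _ _ => 1, fun z => ⟨(), ?_, ?_⟩⟩⟩
    · intro i hi; omega
    · intro i j hij hj; omega
  | succ m ih =>
    obtain ⟨S, hS, D, ih⟩ := ih
    obtain ⟨ι, hι, hHJ⟩ := Combinatorics.Line.exists_mono_in_high_dimension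
      (Option (S × Fin (m + 1) × κ × Q)) (S × (Fin (m + 1) → κ))
    let e : ι → ℕ := fun l => (Fintype.equivFin ι l : ℕ)
    have he : Function.Injective e := fun a b h =>
      (Fintype.equivFin ι).injective (Fin.ext h)
    refine ⟨S × (ι → Option (S × Fin (m + 1) × κ × Q)) × Finset ι × κ, inferInstance,
      max D (Fintype.card ι), fun u hu => ?_⟩
    obtain ⟨off, y, hy⟩ := ih u (fun i t σ hσ => hu i t σ
      (hσ.trans (range_subset_range.2 (le_max_left _ _))))
    let sh : ι → Option (S × Fin (m + 1) × κ × Q) → K := fun l γ => γ.elim 0 (fun a =>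
      (a.2.2.2 : K) * (∏ k ∈ Ico (a.2.1 : ℕ) m, y a.1 k) * u m a.2.2.1 (e l) /
        ∏ k ∈ range a.2.1, y a.1 k)
    refine ⟨fun a => off a.1 + ∑ l, sh l (a.2.1 l),
      fun a i => if i < m then y a.1 i else ∑ l ∈ a.2.2.1, u m a.2.2.2 (e l), fun z => ?_⟩
    choose sel hsel using hy
    obtain ⟨L, ⟨s, cols⟩, hL⟩ := hHJ (fun w =>
      (sel (z + ∑ l, sh l (w l)),
        fun i => χ ((z + ∑ l, sh l (w l) + off (sel (z + ∑ l, sh l (w l)))) *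
          ∏ k ∈ range i, y (sel (z + ∑ l, sh l (w l))) k)))
    have hs : ∀ γ, sel (z + ∑ l, sh l (L γ l)) = s := fun γ => congrArg Prod.fst (hL γ)
    have hcol : ∀ γ (i : Fin (m + 1)), χ ((z + ∑ l, sh l (L γ l) + off s) * ∏ k ∈ range i, y s k)
        = cols i := by
      intro γ i
      have h := congrFun (congrArg Prod.snd (hL γ)) i
      simp only [hs] at h
      exact h
    set σ : Finset ι := univ.filter (fun l => L.idxFun l = none) with hσ
    have hσne : σ.Nonempty := by
      obtain ⟨l, hl⟩ := L.proper
      exact ⟨l, by simp [hσ, hl]⟩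
    have hsum : ∀ γ, ∑ l, sh l (L γ l) = ∑ l, sh l (L none l) + ∑ l ∈ σ, sh l γ := by
      intro γ
      rw [hσ, Finset.sum_filter, ← Finset.sum_add_distrib]
      refine Finset.sum_congr rfl fun l _ => ?_
      by_cases h : L.idxFun l = none
      · simp [h, sh]
      · obtain ⟨a, ha⟩ := Option.ne_none_iff_exists'.1 h
        simp [ha]
    set X : K := z + (off s + ∑ l, sh l (L none l)) with hX
    set t : κ := χ (X * ∏ k ∈ range m, y s k) with ht
    have hsel' := hsel (z + ∑ l, sh l (L none l))
    rw [hs, show z + ∑ l, sh l (L none l) + off s = X by rw [hX]; ring] at hsel'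
    have hcol' : ∀ i : Fin (m + 1), χ (X * ∏ k ∈ range i, y s k) = cols i := by
      intro i
      rw [← hcol none i, hX]
      congr 2
      ring
    have hys : ∀ i < m, y s i ≠ 0 := by
      intro i hi
      obtain ⟨τ, hτ, hne, h⟩ := hsel'.1 i hi
      rw [h]
      exact hu _ _ _ (hτ.trans (range_subset_range.2 (le_max_left _ _))) hne
    refine ⟨(s, L none, σ, t), ?_⟩
    set y' : ℕ → K := fun i => if i < m then y s i else ∑ l ∈ σ, u m t (e l) with hy'
    have hy'lt : ∀ i < m, y' i = y s i := fun i hi => if_pos hi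
    have hy'm : y' m = ∑ l ∈ σ, u m t (e l) := if_neg (lt_irrefl m)
    have hP : ∀ i ≤ m, ∏ k ∈ range i, y' k = ∏ k ∈ range i, y s k := fun i hi =>
      Finset.prod_congr rfl fun k hk => hy'lt k ((mem_range.1 hk).trans_le hi)
    have hI : ∀ i j, j ≤ m → ∏ k ∈ Ico i j, y' k = ∏ k ∈ Ico i j, y s k := fun i j hj =>
      Finset.prod_congr rfl fun k hk => hy'lt k ((mem_Ico.1 hk).2.trans_le hj)
    change (∀ i < m + 1, ∃ τ ⊆ range (max D (Fintype.card ι)), τ.Nonempty ∧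
          y' i = ∑ l ∈ τ, u i (χ (X * ∏ l ∈ range i, y' l)) l) ∧
        ∀ i j, i < j → j ≤ m + 1 → ∀ q ∈ Q,
          χ (X * ∏ l ∈ range i, y' l + q * ∏ l ∈ Ico i j, y' l) = χ (X * ∏ l ∈ range i, y' l)
    constructor
    · intro i hi
      rcases Nat.lt_succ_iff_lt_or_eq.1 hi with hi | rfl
      · obtain ⟨τ, hτ, hne, h⟩ := hsel'.1 i hi
        refine ⟨τ, hτ.trans (range_subset_range.2 (le_max_left _ _)), hne, ?_⟩
        rw [hP i hi.le, hy'lt i hi, h]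
      · refine ⟨σ.image e, ?_, hσne.image e, ?_⟩
        · intro k hk
          obtain ⟨l, -, rfl⟩ := mem_image.1 hk
          exact mem_range.2 ((Fintype.equivFin ι l).2.trans_le (le_max_right _ _))
        · rw [hy'm, hP _ le_rfl, ← ht, Finset.sum_image he.injOn]
    · intro i j hij hj q hq
      rcases Nat.le_succ_iff.1 hj with hj | rfl
      · rw [hP i (hij.le.trans hj), hI i j hj]
        exact hsel'.2 i j hij hj q hq
      · have him : i ≤ m := Nat.lt_succ_iff.1 hij
        have hPi : ∏ k ∈ range i, y s k ≠ 0 := Finset.prod_ne_zero_iff.2 fun k hk =>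
          hys k ((mem_range.1 hk).trans_le him)
        have h1 := hcol (some (s, ⟨i, hij⟩, t, ⟨q, hq⟩)) ⟨i, hij⟩
        rw [← hcol' ⟨i, hij⟩, hsum] at h1
        have h2 : ∑ l ∈ σ, sh l (some (s, ⟨i, hij⟩, t, ⟨q, hq⟩)) =
            q * (∏ k ∈ Ico i m, y s k) * (∑ l ∈ σ, u m t (e l)) / ∏ k ∈ range i, y s k := by
          rw [Finset.mul_sum, Finset.sum_div]
          rfl
        rw [hP i him, ← h1, h2, Finset.prod_Ico_succ_top him, hI i m le_rfl, hy'm, hX]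
        generalize ∑ l, sh l (L none l) = a
        congr 1
        field_simp
        ring

attribute [local instance] Ultrafilter.mul Ultrafilter.semigroup Ultrafilter.add
  Ultrafilter.addSemigroup

theorem exists_minimal_idempotent {M : Type*} [Nonempty M] [Semigroup M] [TopologicalSpace M]
    [CompactSpace M] [T2Space M] (hcont : ∀ r : M, Continuous (· * r)) :
    ∃ e : M, e * e = e ∧ ∀ v, ∃ r, r * v * e = e := by
  let 𝒮 : Set (Set M) := {N | IsClosed N ∧ N.Nonempty ∧ ∀ a, ∀ x ∈ N, a * x ∈ N}
  obtain ⟨N, hN⟩ : ∃ N, Minimal (· ∈ 𝒮) N := by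
    refine zorn_superset _ fun C hC hchain => ?_
    refine ⟨⋂₀ C, ⟨isClosed_sInter fun t ht => (hC ht).1, ?_, fun a x hx t ht =>
      (hC ht).2.2 a x (hx t ht)⟩, fun s hs => Set.sInter_subset_of_mem hs⟩
    obtain rfl | hne := C.eq_empty_or_nonempty
    · simp
    · have := hne.to_subtype
      exact IsCompact.nonempty_sInter_of_directed_nonempty_isCompact_isClosed
        (IsChain.directedOn hchain.symm) (fun t ht => (hC ht).2.1)
        (fun t ht => (hC ht).1.isCompact) (fun t ht => (hC ht).1)
  obtain ⟨hclosed, hne, hideal⟩ := hN.prop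
  obtain ⟨e, he, hee⟩ := exists_idempotent_in_compact_subsemigroup hcont N hne
    hclosed.isCompact fun x _ y hy => hideal x y hy
  refine ⟨e, hee, fun v => ?_⟩
  have hrange : Set.range (· * (v * e)) = N := by
    refine hN.eq_of_subset ⟨?_, Set.range_nonempty _, ?_⟩ ?_
    · exact (isCompact_range (hcont _)).isClosed
    · rintro a _ ⟨b, rfl⟩
      exact ⟨a * b, mul_assoc _ _ _⟩
    · rintro _ ⟨b, rfl⟩
      exact hideal _ _ (hideal _ _ he)
  rw [← hrange] at he
  obtain ⟨r, hr⟩ := he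
  exact ⟨r, by rw [mul_assoc]; exact hr⟩

/-- Every member of `v` contains all nonempty subset sums of arbitrarily long finite sequences. -/
def IsSumRich (v : Ultrafilter ℚˣ) : Prop :=
  ∀ A ∈ v, ∀ D : ℕ, ∃ u : ℕ → ℚ, ∀ σ ⊆ range D, σ.Nonempty → ∃ a ∈ A, ∑ l ∈ σ, u l = a

theorem IsSumRich.mul_left {v : Ultrafilter ℚˣ} (hv : IsSumRich v) (r : Ultrafilter ℚˣ) :
    IsSumRich (r * v) := by
  intro A hA D
  obtain ⟨x, hx⟩ := ((Ultrafilter.eventually_mul r v (· ∈ A)).1 hA).exists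
  obtain ⟨u, hu⟩ := hv _ hx D
  refine ⟨fun l => x * u l, fun σ hσ hne => ?_⟩
  obtain ⟨a, ha, h⟩ := hu σ hσ hne
  exact ⟨x * a, ha, by rw [← Finset.mul_sum, h, Units.val_mul]⟩

theorem IsSumRich.mul_right {v : Ultrafilter ℚˣ} (hv : IsSumRich v) (r : Ultrafilter ℚˣ) :
    IsSumRich (v * r) := by
  intro A hA D
  obtain ⟨u, hu⟩ := hv _ ((Ultrafilter.eventually_mul v r (· ∈ A)).1 hA) D
  have h : ∀ᶠ y : ℚˣ in r, ∀ σ ∈ (range D).powerset, σ.Nonempty →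
      ∃ a ∈ A, ∑ l ∈ σ, u l * (y : ℚ) = a := by
    refine (Filter.eventually_all_finset _).2 fun σ hσ => ?_
    by_cases hne : σ.Nonempty
    · obtain ⟨a, ha, h⟩ := hu σ (mem_powerset.1 hσ) hne
      filter_upwards [ha] with y hy _
      exact ⟨a * y, hy, by rw [← Finset.sum_mul, h, Units.val_mul]⟩
    · exact Filter.Eventually.of_forall fun y h => absurd h hne
  obtain ⟨y, hy⟩ := h.exists
  exact ⟨fun l => u l * y, fun σ hσ => hy σ (mem_powerset.2 hσ)⟩

theorem exists_isSumRich : ∃ v, IsSumRich v := by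
  obtain ⟨U, hU⟩ := exists_idempotent_of_compact_t2_of_continuous_add_left
    (Ultrafilter.continuous_add_left (M := ℕ+))
  have key : ∀ D : ℕ, ∀ A ∈ U, ∃ u : ℕ → ℚ, ∀ σ ⊆ range D, σ.Nonempty →
      ∃ a ∈ A, ∑ l ∈ σ, u l = ((a : ℕ) : ℚ) := by
    intro D
    induction D with
    | zero => exact fun A _ => ⟨0, fun σ hσ hne => by simp_all⟩
    | succ D ih =>
      intro A hA
      have hA' : ∀ᶠ n in U, ∀ᶠ m in U, n + m ∈ A :=
        (Ultrafilter.eventually_add U U (· ∈ A)).1 (by rw [hU]; exact hA)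
      obtain ⟨n, hn, hn'⟩ := (Filter.Eventually.and hA hA').exists
      obtain ⟨u, hu⟩ := ih {m | m ∈ A ∧ n + m ∈ A} (Filter.Eventually.and hA hn')
      refine ⟨Function.update u D ((n : ℕ) : ℚ), fun σ hσ hne => ?_⟩
      have hsum : ∀ τ ⊆ range D, ∑ l ∈ τ, Function.update u D ((n : ℕ) : ℚ) l = ∑ l ∈ τ, u l :=
        fun τ hτ => Finset.sum_congr rfl fun l hl =>
          Function.update_of_ne (mem_range.1 (hτ hl)).ne _ _
      by_cases hD : D ∈ σ
      · have hsub : σ.erase D ⊆ range D := fun l hl => by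
          have h1 := mem_range.1 (hσ (mem_of_mem_erase hl))
          have h2 := ne_of_mem_erase hl
          exact mem_range.2 (by omega)
        rw [← Finset.add_sum_erase _ _ hD, Function.update_self, hsum _ hsub]
        obtain h | h := (σ.erase D).eq_empty_or_nonempty
        · exact ⟨n, hn, by simp [h]⟩
        · obtain ⟨a, ha, h⟩ := hu _ hsub h
          exact ⟨n + a, ha.2, by rw [h]; push_cast; rfl⟩
      · have hsub : σ ⊆ range D := fun l hl => by
          have h1 := mem_range.1 (hσ hl)
          have h2 : l ≠ D := fun h => hD (h ▸ hl)
          exact mem_range.2 (by omega)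
        obtain ⟨a, ha, h⟩ := hu σ hsub hne
        exact ⟨a, ha.1, by rw [hsum σ hsub, h]⟩
  refine ⟨U.map fun n : ℕ+ => Units.mk0 ((n : ℕ) : ℚ) (by exact_mod_cast n.ne_zero),
    fun A hA D => ?_⟩
  obtain ⟨u, hu⟩ := key D _ (Ultrafilter.mem_map.1 hA)
  refine ⟨u, fun σ hσ hne => ?_⟩
  obtain ⟨a, ha, h⟩ := hu σ hσ hne
  exact ⟨_, ha, h⟩

theorem exists_idempotent_family {κ : Type*} [Finite κ] (c : ℚ → κ) :
    ∃ (T : Set κ) (E : κ → Ultrafilter ℚˣ),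
      (∀ t ∈ T, IsSumRich (E t) ∧ ∀ᶠ x : ℚˣ in E t, c ↑x = t) ∧
      (∀ s ∈ T, ∀ t ∈ T, E s * E t = E t) ∧
      ∃ F : Finset ℚˣ, ∀ x : ℚˣ, ∃ f ∈ F, c ↑(f * x) ∈ T := by
  classical
  obtain ⟨e, hee, he⟩ := exists_minimal_idempotent (Ultrafilter.continuous_mul_left (M := ℚˣ))
  have hrich : IsSumRich e := by
    obtain ⟨v, hv⟩ := exists_isSumRich
    obtain ⟨r, hr⟩ := he v
    rw [← hr]
    exact (hv.mul_left r).mul_right e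
  let T : Set κ := {t | ∃ e', e * e' = e' ∧ e' * e = e ∧ ∀ᶠ x : ℚˣ in e', c ↑x = t}
  have hT : ∀ t : κ, ∃ e', t ∈ T → e * e' = e' ∧ e' * e = e ∧ ∀ᶠ x : ℚˣ in e', c ↑x = t := by
    intro t
    by_cases ht : t ∈ T
    · exact ht.imp fun e' h _ => h
    · exact ⟨e, fun h => absurd h ht⟩
  choose E hE using hT
  refine ⟨T, E, fun t ht => ⟨?_, (hE t ht).2.2⟩, fun s hs t ht => ?_, ?_⟩
  · rw [← (hE t ht).1]
    exact hrich.mul_right _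
  · rw [← (hE t ht).1, ← mul_assoc, (hE s hs).2.1]
  · by_contra! hF
    obtain ⟨v, hv⟩ := Ultrafilter.exists_ultrafilter_of_finite_inter_nonempty
      ((fun f : ℚˣ => {x : ℚˣ | c ↑(f * x) ∉ T}) '' Set.univ) (by
        intro 𝒢 h𝒢
        obtain ⟨F, -, rfl⟩ := Finset.subset_set_image_iff.1 h𝒢
        obtain ⟨x, hx⟩ := hF F
        exact ⟨x, by simpa using hx⟩)
    obtain ⟨r, hr⟩ := he v
    have h1 : ∀ᶠ x : ℚˣ in (e * r * v : Ultrafilter ℚˣ), c ↑x ∉ T :=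
      (Ultrafilter.eventually_mul _ _ fun x : ℚˣ => c ↑x ∉ T).2 (Filter.Eventually.of_forall fun f =>
        hv ⟨f, Set.mem_univ _, rfl⟩)
    obtain ⟨t, ht⟩ : ∃ t, ∀ᶠ x : ℚˣ in (e * r * v : Ultrafilter ℚˣ), c ↑x = t :=
      Ultrafilter.eventually_exists_iff.1 (Filter.Eventually.of_forall fun x => ⟨c ↑x, rfl⟩)
    have htT : t ∈ T := ⟨e * r * v, by rw [← mul_assoc, ← mul_assoc, hee],
      by rw [mul_assoc e, mul_assoc, hr, hee], ht⟩
    obtain ⟨x, hx, rfl⟩ := (h1.and ht).exists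
    exact hx htT

/-- Sums drawn from the sequences `u i t` force the color of every window of products: the window
starting at `i` has the color `t` of the sequence from which its first factor was drawn. -/
theorem exists_color_prescribing_sums {κ : Type*} [Finite κ] (c : ℚ → κ) (T : Set κ)
    (E : κ → Ultrafilter ℚˣ) (hE : ∀ t ∈ T, IsSumRich (E t) ∧ ∀ᶠ x : ℚˣ in E t, c ↑x = t)
    (hmul : ∀ s ∈ T, ∀ t ∈ T, E s * E t = E t) (D m : ℕ) :
    ∃ (u : ℕ → κ → ℕ → ℚ) (W : Set ℚˣ), W.Finite ∧ 1 ∈ W ∧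
      (∀ w ∈ W, ∀ t ∈ T, ∀ᶠ x : ℚˣ in E t, c ↑(x * w) = t) ∧
      (∀ i, ∀ t ∈ T, ∀ σ ⊆ range D, σ.Nonempty → ∑ l ∈ σ, u i t l ≠ 0) ∧
      ∀ y : ℕ → ℚ, (∀ i < m, ∃ t ∈ T, ∃ σ ⊆ range D, σ.Nonempty ∧ y i = ∑ l ∈ σ, u i t l) →
        (∀ j ≤ m, ∃ w ∈ W, ∏ l ∈ range j, y l = w) ∧
        ∀ i j, i < j → j ≤ m → ∀ t ∈ T, ∀ σ ⊆ range D, σ.Nonempty → y i = ∑ l ∈ σ, u i t l →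
          c (∏ l ∈ Ico i j, y l) = t := by
  classical
  induction m with
  | zero =>
    refine ⟨fun _ _ _ => 1, {1}, Set.finite_singleton _, rfl, ?_, ?_, fun y _ => ⟨?_, ?_⟩⟩
    · rintro w rfl t ht
      simpa using (hE t ht).2
    · intro i t _ σ _ hne
      simpa using hne.ne_empty
    · intro j hj
      exact ⟨1, rfl, by simp [Nat.le_zero.1 hj]⟩
    · intro i j hij hj
      omega
  | succ m ih =>
    obtain ⟨u, W, hWfin, hW1, hW, hu, hy⟩ := ih
    let A : κ → Set ℚˣ := fun t => {x | ∀ w ∈ W, c ↑(x * w) = t ∧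
      ∀ s ∈ T, ∀ᶠ x' : ℚˣ in E s, c ↑(x' * (x * w)) = s}
    have hA : ∀ t ∈ T, A t ∈ E t := by
      intro t ht
      refine (Filter.eventually_all_finite hWfin).2 fun w hw => (hW w hw t ht).and
        ((Filter.eventually_all_finite T.toFinite).2 fun s hs => ?_)
      have h := hW w hw s hs
      rw [← hmul t ht s hs, Ultrafilter.eventually_mul] at h
      simpa only [mul_assoc, mul_left_comm] using h
    have hrich : ∀ t : T, ∃ v : ℕ → ℚ, ∀ σ : {σ // σ ∈ (range D).powerset.filter Finset.Nonempty},
        ∃ a ∈ A t, ∑ l ∈ σ.1, v l = (a : ℚ) := by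
      intro t
      obtain ⟨v, hv⟩ := (hE t t.2).1 _ (hA t t.2) D
      refine ⟨v, fun σ => ?_⟩
      have hσ := mem_filter.1 σ.2
      exact hv _ (mem_powerset.1 hσ.1) hσ.2
    choose v g hgA hg using hrich
    let u₀ : κ → ℕ → ℚ := fun t l => if ht : t ∈ T then v ⟨t, ht⟩ l else 0
    have hu₀ : ∀ t (ht : t ∈ T), ∀ σ ⊆ range D, σ.Nonempty →
        ∃ p : T × {σ // σ ∈ (range D).powerset.filter Finset.Nonempty},
          p.1.1 = t ∧ ∑ l ∈ σ, u₀ t l = (g p.1 p.2 : ℚ) := by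
      intro t ht σ hσ hne
      refine ⟨(⟨t, ht⟩, ⟨σ, mem_filter.2 ⟨mem_powerset.2 hσ, hne⟩⟩), rfl, ?_⟩
      simp only [u₀, dif_pos ht]
      exact hg ⟨t, ht⟩ ⟨σ, _⟩
    let G : Set ℚˣ := Set.range fun p : T × {σ // σ ∈ (range D).powerset.filter Finset.Nonempty} =>
      g p.1 p.2
    refine ⟨fun i => i.casesOn u₀ u, insert 1 (Set.image2 (· * ·) G W),
      ((Set.finite_range _).image2 _ hWfin).insert _, Set.mem_insert _ _, ?_, ?_, fun y hyu => ?_⟩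
    · rintro w (rfl | ⟨_, ⟨p, rfl⟩, w, hw, rfl⟩) t ht
      · exact hW 1 hW1 t ht
      · exact (hgA p.1 p.2 w hw).2 t ht
    · rintro (_ | i) t ht σ hσ hne
      · obtain ⟨p, -, h⟩ := hu₀ t ht σ hσ hne
        exact fun h0 => Units.ne_zero _ (h.symm.trans h0)
      · exact hu i t ht σ hσ hne
    · obtain ⟨hy1, hy2⟩ := hy (fun i => y (i + 1)) (fun i hi => hyu (i + 1) (by omega))
      constructor
      · rintro (_ | j) hj
        · exact ⟨1, Set.mem_insert _ _, by simp⟩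
        · obtain ⟨w, hw, h⟩ := hy1 j (by omega)
          obtain ⟨t, ht, σ, hσ, hne, h0⟩ := hyu 0 (by omega)
          obtain ⟨p, -, hp⟩ := hu₀ t ht σ hσ hne
          refine ⟨g p.1 p.2 * w, Set.mem_insert_of_mem _ ⟨_, ⟨p, rfl⟩, w, hw, rfl⟩, ?_⟩
          rw [Finset.prod_range_succ', h, h0.trans hp, Units.val_mul, mul_comm]
      · rintro (_ | i) (_ | j) hij hj t ht σ hσ hne h0
        · omega
        · obtain ⟨w, hw, h⟩ := hy1 j (by omega)
          obtain ⟨p, hpt, hp⟩ := hu₀ t ht σ hσ hne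
          rw [← Finset.range_eq_Ico, Finset.prod_range_succ', h, h0.trans hp, mul_comm,
            ← Units.val_mul, (hgA p.1 p.2 w hw).1, hpt]
        · omega
        · rw [← Finset.prod_Ico_add']
          exact hy2 i j (by omega) (by omega) t ht σ hσ hne h0

theorem exists_mono_quadruple_rat {κ : Type} [Finite κ] (c : ℚ → κ) :
    ∃ x y : ℚ, x ≠ 0 ∧ y ≠ 0 ∧ c y = c x ∧ c (x * y) = c x ∧ c (x + y) = c x := by
  classical
  obtain ⟨T, E, hE, hmul, F, hF⟩ := exists_idempotent_family c
  let χ : ℚ → F → κ := fun x f => c (f.1 * x)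
  have hτ : ∀ φ : F → κ, ∃ t ∈ T, (∃ f, φ f ∈ T) → ∃ f, φ f = t := by
    intro φ
    by_cases h : ∃ f, φ f ∈ T
    · obtain ⟨f, hf⟩ := h
      exact ⟨_, hf, fun _ => ⟨f, rfl⟩⟩
    · obtain ⟨f, -, hf⟩ := hF 1
      exact ⟨_, hf, fun h' => absurd h' h⟩
  choose τ hτT hτ using hτ
  obtain ⟨S, hS, D, hA⟩ := exists_shifts_of_coloring χ (F.image fun f : ℚˣ => (f : ℚ)⁻¹)
    (Nat.card (F → κ))
  obtain ⟨u, W, -, -, -, hu, hB⟩ :=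
    exists_color_prescribing_sums c T E hE hmul D (Nat.card (F → κ))
  obtain ⟨off, y, hy⟩ := hA (fun i φ => u i (τ φ)) fun i φ σ hσ hne => hu i _ (hτT φ) σ hσ hne
  obtain ⟨z, hz⟩ := (Set.finite_range fun s => -off s).exists_notMem
  obtain ⟨s, hys, hχ⟩ := hy z
  have hX : z + off s ≠ 0 := fun h => hz ⟨s, (eq_neg_of_add_eq_zero_left h).symm⟩
  set X : ℕ → ℚ := fun i => (z + off s) * ∏ l ∈ range i, y s l with hXdef
  have hy0 : ∀ i < Nat.card (F → κ), y s i ≠ 0 := by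
    intro i hi
    obtain ⟨σ, hσ, hne, h⟩ := hys i hi
    rw [h]
    exact hu i _ (hτT _) σ hσ hne
  have hB' := (hB (y s) fun i hi => by
    obtain ⟨σ, hσ, hne, h⟩ := hys i hi
    exact ⟨_, hτT _, σ, hσ, hne, h⟩).2
  obtain ⟨i, j, hij, hj, hχij⟩ :
      ∃ i j, i < j ∧ j ≤ Nat.card (F → κ) ∧ χ (X i) = χ (X j) := by
    have := Fintype.ofFinite (F → κ)
    obtain ⟨i, j, hne, h⟩ := Fintype.exists_ne_map_eq_of_card_lt
      (fun i : Fin (Nat.card (F → κ) + 1) => χ (X i)) (by simp [Nat.card_eq_fintype_card])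
    rcases lt_or_gt_of_ne hne with hlt | hlt
    · exact ⟨i, j, hlt, Nat.lt_succ_iff.1 j.2, h⟩
    · exact ⟨j, i, hlt, Nat.lt_succ_iff.1 i.2, h.symm⟩
  have hXi : X i ≠ 0 := mul_ne_zero hX <| Finset.prod_ne_zero_iff.2 fun l hl =>
    hy0 l ((mem_range.1 hl).trans (hij.trans_le hj))
  obtain ⟨f, hf⟩ := hτ (χ (X i)) (by
    obtain ⟨f, hf, h⟩ := hF (Units.mk0 _ hXi)
    exact ⟨⟨f, hf⟩, by simpa using h⟩)
  have hf0 : (f.1 : ℚ) ≠ 0 := Units.ne_zero _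
  obtain ⟨σ, hσ, hne, hyi⟩ := hys i (hij.trans_le hj)
  have hcy := hB' i j hij hj _ (hτT _) σ hσ hne hyi
  have hmulX : X i * ∏ l ∈ Ico i j, y s l = X j := by
    rw [hXdef, mul_assoc, Finset.prod_range_mul_prod_Ico _ hij.le]
  have hadd := congrFun (hχ i j hij hj _ (mem_image_of_mem _ f.2)) f
  refine ⟨f.1 * X i, ∏ l ∈ Ico i j, y s l, mul_ne_zero hf0 hXi,
    Finset.prod_ne_zero_iff.2 fun l hl => hy0 l ((mem_Ico.1 hl).2.trans_le hj), ?_, ?_, ?_⟩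
  · exact hcy.trans hf.symm
  · rw [mul_assoc, hmulX]
    exact (congrFun hχij f).symm
  · simp only [χ] at hadd
    rw [mul_add, mul_inv_cancel_left₀ hf0] at hadd
    exact hadd

/-- For every `n` there exists `p₀` such that for every prime `p > p₀`, every coloring
of `ℤ/pℤ` with `n` colors admits nonzero `x y` with `{x, y, x*y, x+y}` monochromatic. -/
theorem hindman_quadruple_ZMod (n : ℕ) :
    ∃ p₀ : ℕ, ∀ p : ℕ, p.Prime → p > p₀ →
      ∀ c : ZMod p → Fin n,
        ∃ x y : ZMod p, x ≠ 0 ∧ y ≠ 0 ∧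
          c y = c x ∧ c (x * y) = c x ∧ c (x + y) = c x := by
  by_contra! h
  choose p hp hlt c hc using h
  have (k : ℕ) : Fact (p k).Prime := ⟨hp k⟩
  let U : Ultrafilter ℕ := Filter.hyperfilter ℕ
  have hlim : ∀ q : ℚ, ∃ t, ∀ᶠ k in U, c k (q : ZMod (p k)) = t := fun q =>
    Ultrafilter.eventually_exists_iff.1 (Filter.Eventually.of_forall fun k => ⟨_, rfl⟩)
  choose c' hc' using hlim
  have hcast : ∀ a : ℤ, a ≠ 0 → ∀ᶠ k in U, (a : ZMod (p k)) ≠ 0 := by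
    intro a ha
    have hlarge : ∀ᶠ k in U, a.natAbs < k :=
      Nat.hyperfilter_le_atTop (Filter.eventually_gt_atTop a.natAbs)
    filter_upwards [hlarge] with k hk h0
    rw [ZMod.intCast_zmod_eq_zero_iff_dvd] at h0
    have := Nat.le_of_dvd (Int.natAbs_pos.2 ha) (Int.natCast_dvd.1 h0)
    have := hlt k
    omega
  have hden : ∀ q : ℚ, ∀ᶠ k in U, (q.den : ZMod (p k)) ≠ 0 := fun q => by
    simpa using hcast q.den (by exact_mod_cast q.den_nz)
  have hne : ∀ q : ℚ, q ≠ 0 → ∀ᶠ k in U, (q : ZMod (p k)) ≠ 0 := fun q hq => by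
    filter_upwards [hden q, hcast q.num (Rat.num_ne_zero.2 hq)] with k h1 h2
    rw [Rat.cast_def]
    exact div_ne_zero h2 h1
  obtain ⟨x, y, hx, hy, h1, h2, h3⟩ := exists_mono_quadruple_rat c'
  obtain ⟨k, hx, hy, hxd, hyd, ex, ey, exy, exy'⟩ := ((hne x hx).and <| (hne y hy).and <|
    (hden x).and <| (hden y).and <| (hc' x).and <| (hc' y).and <| (hc' (x * y)).and
    (hc' (x + y))).exists
  rw [Rat.cast_mul_of_ne_zero hxd hyd] at exy
  rw [Rat.cast_add_of_ne_zero hxd hyd] at exy'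
  exact hc k x y hx hy (by rw [ex, ey, h1]) (by rw [ex, exy, h2]) (by rw [ex, exy', h3])
end

section
/- For every natural number k and any coloring of the rational numbers into finitely many colors, there exist nonzero rationals x and y such that the set {x, y, x*y} ∪ {x + i*y : i = 1, …, k} is monochromatic. -/
section RecurrentTranslates

open Finset Combinatorics

attribute [local instance] Ultrafilter.semigroup Ultrafilter.addSemigroup

/-- The sum of the weights of the coordinates selected by `I l`, at stage `l`. -/
def blockSum {Θ : Type} (e : ℕ → Θ → ℕ → ℚ) (I : ℕ → Finset ℕ) (θ : Θ) (l : ℕ) : ℚ :=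
  ∑ q ∈ I l, e l θ q

/-- Moving along a combinatorial line away from `none` adds the weights of its active coordinates. -/
theorem Combinatorics.Line.sum_apply_some {α ι : Type} [Fintype ι] [DecidableEq ι]
    (L : Line (Option α) ι) (S : Option α → ι → ℚ) (hS : ∀ i, S none i = 0) (a : α) :
    ∑ i, S (L (some a) i) i =
      ∑ i, S (L none i) i + ∑ i with L.idxFun i = none, S (some a) i := by
  rw [Finset.sum_filter, ← Finset.sum_add_distrib]
  refine Finset.sum_congr rfl fun i _ => ?_
  rw [Line.apply_def, Line.apply_def]
  cases h : L.idxFun i <;> simp [h, hS]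

/-- Finitely many block choices suffice for simultaneous additive recurrence: for any weights `e`, every
translate `z` has a shift `w ω` whose multiples by the partial products of block sums keep their color
when multiples of the complementary products are added. -/
theorem exists_recurrent_translate {Θ κ : Type} [Finite Θ] [Finite κ] (F : Finset ℚˣ) (k m : ℕ) :
    ∃ (Ω : Type) (_ : Finite Ω) (N : ℕ) (I : Ω → ℕ → Finset ℕ),
      (∀ ω l, (I ω l).Nonempty ∧ I ω l ⊆ range N) ∧
      ∀ e : ℕ → Θ → ℕ → ℚ,
        (∀ l θ J, J.Nonempty → J ⊆ range N → ∑ q ∈ J, e l θ q ≠ 0) →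
        ∃ w : Ω → ℚ, ∀ (c : ℚ → κ) (z : ℚ), ∃ ω, ∀ θ i j, i < j → j ≤ m → ∀ f ∈ F, ∀ s ≤ k,
          c ((z + w ω) * ((∏ l ∈ range i, blockSum e (I ω) θ l) * (f : ℚ)) +
              s * ∏ l ∈ Ico i j, blockSum e (I ω) θ l) =
            c ((z + w ω) * ((∏ l ∈ range i, blockSum e (I ω) θ l) * (f : ℚ))) := by
  classical
  induction m with
  | zero =>
    refine ⟨Unit, inferInstance, 1, fun _ _ => range 1, fun _ _ => ⟨⟨0, by simp⟩, le_rfl⟩,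
      fun e _ => ⟨fun _ => 0, fun c z => ⟨(), fun θ i j hij hj => by omega⟩⟩⟩
  | succ m ih =>
    obtain ⟨Ω, _, N, I, hI, H⟩ := ih
    let β := Ω × Θ × Fin (m + 1) × F × Fin (k + 1)
    let κ' := Ω × (Θ × Fin (m + 1) × F → κ)
    obtain ⟨ι, _, hι⟩ := Line.exists_mono_in_high_dimension (Option β) κ'
    let ε : ι ↪ ℕ := (Fintype.equivFin ι).toEmbedding.trans Fin.valEmbedding
    let A : Line (Option β) ι → Finset ι := fun L => {i | L.idxFun i = none}
    let I' : Ω × Line (Option β) ι → ℕ → Finset ℕ := fun p =>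
      Function.update (I p.1) m ((A p.2).map ε)
    have hlt : ∀ p l, l < m → I' p l = I p.1 l := fun p l hl =>
      Function.update_of_ne hl.ne _ _
    have : Finite (Line (Option β) ι) :=
      Finite.of_injective (fun L => L.idxFun) fun L L' h => by
        cases L; cases L'; simpa using h
    refine ⟨Ω × Line (Option β) ι, inferInstance, max N (Fintype.card ι), I', ?_, ?_⟩
    · rintro ⟨ω, L⟩ l
      by_cases hl : l = m
      · subst hl
        simp only [I', Function.update_self]
        refine ⟨?_, fun q hq => ?_⟩
        · obtain ⟨i, hi⟩ := L.proper
          exact Finset.Nonempty.map ⟨i, by simpa [A] using hi⟩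
        · obtain ⟨i, -, rfl⟩ := Finset.mem_map.1 hq
          exact Finset.mem_range.2 (lt_max_of_lt_right (Fin.is_lt _))
      · simp only [I', Function.update_of_ne hl]
        exact ⟨(hI ω l).1, (hI ω l).2.trans (range_mono (le_max_left _ _))⟩
    · intro e he
      obtain ⟨w, hw⟩ := H e fun l θ J hJ hJN =>
        he l θ J hJ (hJN.trans (range_mono (le_max_left _ _)))
      have hne : ∀ ω θ l, blockSum e (I ω) θ l ≠ 0 := fun ω θ l =>
        he l θ _ (hI ω l).1 ((hI ω l).2.trans (range_mono (le_max_left _ _)))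
      let g : Ω → Θ → ℕ → F → ℚ := fun ω θ i f =>
        (∏ l ∈ range i, blockSum e (I ω) θ l) * (f.1 : ℚ)
      have hg : ∀ ω θ i f, g ω θ i f ≠ 0 := fun ω θ i f =>
        mul_ne_zero (prod_ne_zero_iff.2 fun l _ => hne ω θ l) f.1.ne_zero
      let δ : β → ℚ := fun a =>
        (a.2.2.2.2 : ℕ) * (∏ l ∈ Ico (a.2.2.1 : ℕ) m, blockSum e (I a.1) a.2.1 l) /
          g a.1 a.2.1 a.2.2.1 a.2.2.2.1
      let S : Option β → ι → ℚ := fun a i => a.elim 0 fun a => δ a * e m a.2.1 (ε i)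
      refine ⟨fun p => w p.1 + ∑ i, S (p.2 none i) i, fun c z => ?_⟩
      choose ω hω using hw c
      let C : ℚ → κ' := fun z => (ω z, fun t => c ((z + w (ω z)) * g (ω z) t.1 t.2.1 t.2.2))
      obtain ⟨L, col, hL⟩ := hι fun v => C (z + ∑ i, S (v i) i)
      set z₀ := z + ∑ i, S (L none i) i with hz₀
      refine ⟨(ω z₀, L), ?_⟩
      intro θ i j hij hj f hf s hs
      have hbs : ∀ l, l < m →
          blockSum e (I' (ω z₀, L)) θ l = blockSum e (I (ω z₀)) θ l := fun l hl => by
        simp only [blockSum, hlt _ l hl]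
      have hzw : z + (w (ω z₀) + ∑ i, S (L none i) i) = z₀ + w (ω z₀) := by
        rw [hz₀]; ring
      have hr : ∏ l ∈ range i, blockSum e (I' (ω z₀, L)) θ l =
          ∏ l ∈ range i, blockSum e (I (ω z₀)) θ l :=
        prod_congr rfl fun l hl => hbs l (by have := mem_range.1 hl; omega)
      simp only [hzw, hr]
      rcases Nat.lt_or_ge m j with hmj | hjm
      · obtain rfl : j = m + 1 := by omega
        have hi : i ≤ m := by omega
        rw [prod_Ico_succ_top hi,
          prod_congr rfl fun l hl => hbs l (mem_Ico.1 hl).2]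
        let a : β := (ω z₀, θ, ⟨i, by omega⟩, ⟨f, hf⟩, ⟨s, by omega⟩)
        have hsum : z + ∑ i, S (L (some a) i) i =
            z₀ + δ a * blockSum e (I' (ω z₀, L)) θ m := by
          rw [L.sum_apply_some S (fun _ => rfl), hz₀, add_assoc]
          simp only [blockSum, I', Function.update_self, sum_map, mul_sum]
          rfl
        have hC := (hL (some a)).trans (hL none).symm
        simp only [hsum, ← hz₀] at hC
        have h1 := congrArg Prod.fst hC
        have h2 := congrFun (congrArg Prod.snd hC) (θ, ⟨i, by omega⟩, ⟨f, hf⟩)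
        simp only [C] at h1 h2
        rw [h1] at h2
        rw [show (∏ l ∈ range i, blockSum e (I (ω z₀)) θ l) * (f : ℚ) =
          g (ω z₀) θ i ⟨f, hf⟩ from rfl, ← h2]
        congr 1
        have := hg (ω z₀) θ i ⟨f, hf⟩
        simp only [δ, a]
        field_simp
        ring
      · rw [prod_congr rfl fun l hl => hbs l (lt_of_lt_of_le (mem_Ico.1 hl).2 hjm)]
        exact hω z₀ θ i j hij hjm f hf s hs

/-- A closed left ideal contains an idempotent of a minimal left ideal. -/
theorem exists_idempotent_forall_mul_mul_eq {M : Type*} [Semigroup M] [TopologicalSpace M]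
    [CompactSpace M] [T2Space M] (hM : ∀ r : M, Continuous (· * r)) (A : Set M)
    (hA : IsClosed A) (hne : A.Nonempty) (hmul : ∀ x, ∀ y ∈ A, x * y ∈ A) :
    ∃ e ∈ A, e * e = e ∧ ∀ a, ∃ z, z * a * e = e := by
  let S : Set (Set M) := {N | IsClosed N ∧ N.Nonempty ∧ N ⊆ A ∧ ∀ x, ∀ y ∈ N, x * y ∈ N}
  obtain ⟨L, -, hL⟩ : ∃ L, L ⊆ A ∧ Minimal (· ∈ S) L := by
    refine zorn_superset_nonempty S (fun c hcS hc hcne => ?_) A ⟨hA, hne, le_rfl, hmul⟩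
    refine ⟨⋂₀ c, ⟨isClosed_sInter fun t ht => (hcS ht).1, ?_, ?_, fun x y hy => ?_⟩,
      fun s hs => Set.sInter_subset_of_mem hs⟩
    · rw [Set.sInter_eq_iInter]
      have := hcne.to_subtype
      exact IsCompact.nonempty_iInter_of_directed_nonempty_isCompact_isClosed _
        (DirectedOn.directed_val (IsChain.directedOn hc.symm))
        (fun i => (hcS i.prop).2.1) (fun i => (hcS i.prop).1.isCompact) fun i => (hcS i.prop).1
    · obtain ⟨t, ht⟩ := hcne
      exact (Set.sInter_subset_of_mem ht).trans (hcS ht).2.2.1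
    · exact Set.mem_sInter.2 fun t ht => (hcS ht).2.2.2 x y (Set.mem_sInter.1 hy t ht)
  obtain ⟨hLc, hLne, hLA, hLmul⟩ := hL.prop
  obtain ⟨e, heL, he⟩ := exists_idempotent_in_compact_subsemigroup hM L hLne hLc.isCompact
    fun x _ y hy => hLmul x y hy
  refine ⟨e, hLA heL, he, fun a => ?_⟩
  have hae : a * e ∈ L := hLmul a e heL
  have hsub : Set.range (· * (a * e)) ⊆ L := by
    rintro _ ⟨x, rfl⟩
    exact hLmul x _ hae
  have hrange : Set.range (· * (a * e)) ∈ S := by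
    refine ⟨(isCompact_range (hM _)).isClosed, ⟨_, ⟨e, rfl⟩⟩, hsub.trans hLA, ?_⟩
    rintro x _ ⟨y, rfl⟩
    exact ⟨x * y, mul_assoc _ _ _⟩
  obtain ⟨z, hz⟩ := hL.le_of_le hrange hsub heL
  exact ⟨z, by rw [mul_assoc]; exact hz⟩

theorem Ultrafilter.mem_mul_iff {M : Type*} [Semigroup M] {U V : Ultrafilter M} {A : Set M} :
    A ∈ U * V ↔ {x | {y | x * y ∈ A} ∈ V} ∈ U := Iff.rfl

/-- A set of nonzero rationals containing all subset sums of arbitrarily long finite sequences. -/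
def ContainsSubsetSums (A : Set ℚˣ) : Prop :=
  ∀ N : ℕ, ∃ e : ℕ → ℚ, ∀ J ⊆ range N, J.Nonempty → ∃ a ∈ A, (a : ℚ) = ∑ q ∈ J, e q

theorem isClosed_containsSubsetSums :
    IsClosed {u : Ultrafilter ℚˣ | ∀ A ∈ u, ContainsSubsetSums A} := by
  have : {u : Ultrafilter ℚˣ | ∀ A ∈ u, ContainsSubsetSums A} =
      ⋂ A : {A // ¬ ContainsSubsetSums A}, {u | A.1 ∈ u}ᶜ := by
    ext u
    simp only [Set.mem_ofPred_eq, Set.mem_iInter, Set.mem_compl_iff, Subtype.forall]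
    exact forall_congr' fun A => not_imp_not.symm
  rw [this]
  exact isClosed_iInter fun A => (ultrafilter_isOpen_basic _).isClosed_compl

theorem exists_ultrafilter_containsSubsetSums :
    ∃ u : Ultrafilter ℚˣ, ∀ A ∈ u, ContainsSubsetSums A := by
  obtain ⟨u, hu0, hu⟩ := exists_idempotent_in_compact_add_subsemigroup
    (M := Ultrafilter ℕ) Ultrafilter.continuous_add_left {u | {0}ᶜ ∈ u}
    ⟨pure 1, by simp⟩ (ultrafilter_isClosed_basic _).isCompact fun u hu v hv => by
      refine Filter.mem_of_superset hu fun x hx => Filter.mem_of_superset hv fun y hy => ?_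
      simp_all
  refine ⟨u.map fun n : ℕ => if h : (n : ℚ) ≠ 0 then Units.mk0 (n : ℚ) h else 1,
    fun A hA N => ?_⟩
  obtain ⟨a, ha⟩ := Hindman.exists_FS_of_large u hu _ (Filter.inter_mem hA hu0)
  refine ⟨fun q => (a.get q : ℚ), fun J _ hJ => ?_⟩
  obtain ⟨h₁, h₂⟩ := ha (Hindman.FS.finsetSum a J hJ)
  have h₃ : ((∑ i ∈ J, a.get i : ℕ) : ℚ) ≠ 0 := by exact_mod_cast h₂
  refine ⟨_, h₁, ?_⟩
  exact (congrArg Units.val (dif_pos h₃)).trans (Nat.cast_sum _ _)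

theorem containsSubsetSums_mul_left {u : Ultrafilter ℚˣ} (hu : ∀ A ∈ u, ContainsSubsetSums A)
    (v : Ultrafilter ℚˣ) : ∀ A ∈ v * u, ContainsSubsetSums A := by
  intro A hA N
  obtain ⟨x, hx⟩ := v.nonempty_of_mem (Ultrafilter.mem_mul_iff.1 hA)
  obtain ⟨e, he⟩ := hu _ hx N
  refine ⟨fun q => x * e q, fun J hJN hJ => ?_⟩
  obtain ⟨a, ha, hae⟩ := he J hJN hJ
  exact ⟨x * a, ha, by rw [Units.val_mul, hae, mul_sum]⟩

theorem containsSubsetSums_mul_right {u : Ultrafilter ℚˣ} (hu : ∀ A ∈ u, ContainsSubsetSums A)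
    (v : Ultrafilter ℚˣ) : ∀ A ∈ u * v, ContainsSubsetSums A := by
  classical
  intro A hA N
  obtain ⟨e, he⟩ := hu _ (Ultrafilter.mem_mul_iff.1 hA) N
  choose! a ha hae using he
  have : ∀ᶠ y in (v : Filter ℚˣ), ∀ J ∈ (range N).powerset, J.Nonempty → a J * y ∈ A := by
    rw [Filter.eventually_all_finset]
    intro J hJ
    by_cases hJne : J.Nonempty
    · filter_upwards [ha J (mem_powerset.1 hJ) hJne] with y hy _ using hy
    · exact Filter.Eventually.of_forall fun _ h => absurd h hJne
  obtain ⟨y, hy⟩ := this.exists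
  refine ⟨fun q => e q * y, fun J hJN hJ => ⟨_, hy J (mem_powerset.2 hJN) hJ, ?_⟩⟩
  rw [Units.val_mul, hae J hJN hJ, sum_mul]

/-- Ultrafilters `p t`, indexed by colors, such that `p s * p t = p t` for all `s`, `t` in a set `U` of
colors which is syndetic in the sense that finitely many dilates reach it from every point. -/
theorem exists_ultrafilter_family {κ : Type} [Finite κ] (c : ℚˣ → κ) :
    ∃ (U : Set κ) (p : κ → Ultrafilter ℚˣ),
      (∀ t, ∀ A ∈ p t, ContainsSubsetSums A) ∧ (∀ s ∈ U, ∀ t ∈ U, p s * p t = p t) ∧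
      (∀ t ∈ U, c ⁻¹' {t} ∈ p t) ∧
      ∃ F : Finset ℚˣ, ∀ x, ∃ f ∈ F, c (x * f) ∈ U := by
  obtain ⟨e, heA, he, hz⟩ := exists_idempotent_forall_mul_mul_eq
    (M := Ultrafilter ℚˣ) Ultrafilter.continuous_mul_left _ isClosed_containsSubsetSums
    exists_ultrafilter_containsSubsetSums
    fun v u hu => containsSubsetSums_mul_left hu v
  let R : Set (Ultrafilter ℚˣ) := {p | e * p = p ∧ p * e = e}
  have key : ∀ t, ∃ p : Ultrafilter ℚˣ, (∀ A ∈ p, ContainsSubsetSums A) ∧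
      ((∃ p ∈ R, c ⁻¹' {t} ∈ p) → p ∈ R ∧ c ⁻¹' {t} ∈ p) := by
    intro t
    by_cases h : ∃ p ∈ R, c ⁻¹' {t} ∈ p
    · obtain ⟨p, hp, hpt⟩ := h
      exact ⟨p, hp.1 ▸ containsSubsetSums_mul_right heA p, fun _ => ⟨hp, hpt⟩⟩
    · exact ⟨e, heA, fun h' => absurd h' h⟩
  choose p hp hpR using key
  refine ⟨{t | ∃ p ∈ R, c ⁻¹' {t} ∈ p}, p, hp, fun s hs t ht => ?_, fun t ht => (hpR t ht).2, ?_⟩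
  · rw [← (hpR t ht).1.1, ← mul_assoc, (hpR s hs).1.2]
  · by_contra! hF
    set U : Set κ := {t | ∃ p ∈ R, c ⁻¹' {t} ∈ p} with hU
    choose x hx using hF
    let a : Ultrafilter ℚˣ := (Ultrafilter.of (Filter.atTop : Filter (Finset ℚˣ))).map x
    have ha : ∀ f, {y | c (y * f) ∉ U} ∈ a := by
      intro f
      have : {F : Finset ℚˣ | f ∈ F} ∈ Ultrafilter.of (Filter.atTop : Filter (Finset ℚˣ)) :=
        Ultrafilter.of_le _ (by
          filter_upwards [Filter.eventually_ge_atTop {f}] with F hF using hF (by simp))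
      exact Ultrafilter.mem_map.2 (Filter.mem_of_superset this fun F hF => hx F f hF)
    obtain ⟨z, hz⟩ := hz a
    have hqR : e * (z * a) ∈ R :=
      ⟨by rw [← mul_assoc, he], by rw [mul_assoc, hz, he]⟩
    have hq : {y | c y ∉ U} ∈ e * (z * a) := by
      rw [← mul_assoc, Ultrafilter.mem_mul_iff]
      refine Filter.univ_mem' fun f => ?_
      have := ha f
      simp only [mul_comm _ f] at this
      exact this
    obtain ⟨t, ht⟩ : ∃ t, c ⁻¹' {t} ∈ e * (z * a) := by
      have h := (Ultrafilter.finite_biUnion_mem_iff (f := e * (z * a)) (Set.finite_univ (α := κ))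
        (s := fun t => c ⁻¹' {t})).1 (by
          rw [show ⋃ t ∈ Set.univ, c ⁻¹' {t} = Set.univ by ext; simp]
          exact Filter.univ_mem)
      simpa using h
    obtain ⟨y, hy, hy'⟩ := (e * (z * a)).nonempty_of_mem (Filter.inter_mem hq ht)
    exact hy (by rw [hy']; exact ⟨_, hqR, ht⟩)

/-- Blocks of subset sums whose consecutive products, chosen adaptively with colors `τ`, have the color
prescribed at their first stage. -/
theorem exists_blocks {κ : Type} [Finite κ] (c : ℚˣ → κ) (U : Set κ) (p : κ → Ultrafilter ℚˣ)
    (hp : ∀ t, ∀ A ∈ p t, ContainsSubsetSums A) (hmul : ∀ s ∈ U, ∀ t ∈ U, p s * p t = p t)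
    (hc : ∀ t ∈ U, c ⁻¹' {t} ∈ p t) (N m : ℕ) :
    ∃ (e : ℕ → κ → ℕ → ℚ) (b : ℕ → κ → Finset ℕ → ℚˣ),
      (∀ l t, ∀ J ⊆ range N, J.Nonempty → (b l t J : ℚ) = ∑ q ∈ J, e l t q) ∧
      ∀ τ : ℕ → κ, (∀ l, τ l ∈ U) → ∀ I : ℕ → Finset ℕ, (∀ l, (I l).Nonempty ∧ I l ⊆ range N) →
        ∀ i j, i < j → j ≤ m → c (∏ l ∈ Ico i j, b l (τ l) (I l)) = τ i := by
  classical
  have := Fintype.ofFinite κ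
  let V : Set ℚˣ := {w | ∀ t ∈ U, {b | c (b * w) = t} ∈ p t}
  have hV : ∀ w ∈ V, ∀ s ∈ U, {b | b * w ∈ V} ∈ p s := by
    intro w hw s hs
    have : ∀ᶠ b in (p s : Filter ℚˣ), ∀ t, t ∈ U → {y | c (y * (b * w)) = t} ∈ p t := by
      refine Filter.eventually_all.2 fun t => ?_
      by_cases ht : t ∈ U
      · have h := hw t ht
        rw [← hmul s hs t ht, Ultrafilter.mem_mul_iff] at h
        filter_upwards [h] with b hb _
        simpa only [Set.mem_ofPred_eq, mul_assoc, mul_left_comm b] using hb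
      · exact Filter.Eventually.of_forall fun _ h => absurd h ht
    exact this
  have hsum : ∀ A : κ → Set ℚˣ, (∀ t, A t ∈ p t) → ∃ (e : κ → ℕ → ℚ) (b : κ → Finset ℕ → ℚˣ),
      ∀ t, ∀ J ⊆ range N, J.Nonempty → b t J ∈ A t ∧ (b t J : ℚ) = ∑ q ∈ J, e t q := by
    intro A hA
    choose e he using fun t => hp t (A t) (hA t) N
    choose! b hb using he
    exact ⟨e, b, hb⟩
  suffices H : ∃ (e : ℕ → κ → ℕ → ℚ) (b : ℕ → κ → Finset ℕ → ℚˣ) (W : Finset ℚˣ),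
      (∀ l t, ∀ J ⊆ range N, J.Nonempty → (b l t J : ℚ) = ∑ q ∈ J, e l t q) ∧
      (∀ w ∈ W, w ∈ V) ∧
      ∀ τ : ℕ → κ, (∀ l, τ l ∈ U) → ∀ I : ℕ → Finset ℕ, (∀ l, (I l).Nonempty ∧ I l ⊆ range N) →
        (∀ j ≤ m, ∏ l ∈ range j, b l (τ l) (I l) ∈ W) ∧
        ∀ i j, i < j → j ≤ m → c (∏ l ∈ Ico i j, b l (τ l) (I l)) = τ i by
    obtain ⟨e, b, W, heb, -, h⟩ := H
    exact ⟨e, b, heb, fun τ hτ I hI => (h τ hτ I hI).2⟩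
  have hV1 : (1 : ℚˣ) ∈ V := fun t ht => by simp only [mul_one]; exact hc t ht
  induction m with
  | zero =>
    obtain ⟨e, b, heb⟩ := hsum (fun _ => Set.univ) fun _ => Filter.univ_mem
    refine ⟨fun _ => e, fun _ => b, {1}, fun _ t J hJ hJ' => (heb t J hJ hJ').2, by simpa using hV1,
      fun τ _ I _ => ⟨fun j hj => ?_, fun i j hij hj => by omega⟩⟩
    simp [Nat.le_zero.1 hj]
  | succ m ih =>
    obtain ⟨e, b, W, heb, hWV, hW⟩ := ih
    obtain ⟨e₀, b₀, h₀⟩ := hsum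
      (fun t => {a | ∀ w ∈ W, t ∈ U → c (a * w) = t ∧ a * w ∈ V}) fun t => by
        refine (Filter.eventually_all_finset W).2 fun w hw => ?_
        by_cases ht : t ∈ U
        · filter_upwards [hWV w hw t ht, hV w (hWV w hw) t ht] with a h₁ h₂ _ using ⟨h₁, h₂⟩
        · exact Filter.Eventually.of_forall fun _ h => absurd h ht
    refine ⟨fun l => l.casesOn e₀ e, fun l => l.casesOn b₀ b,
      insert 1 {v ∈ ((univ : Finset κ) ×ˢ (range N).powerset ×ˢ W).image
        fun x => b₀ x.1 x.2.1 * x.2.2 | v ∈ V}, ?_, ?_, fun τ hτ I hI => ?_⟩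
    · rintro (_ | l) t J hJ hJ'
      · exact (h₀ t J hJ hJ').2
      · exact heb l t J hJ hJ'
    · intro w hw
      rcases mem_insert.1 hw with rfl | hw
      · exact hV1
      · exact (mem_filter.1 hw).2
    · obtain ⟨h₁, h₂⟩ := hW (fun l => τ (l + 1)) (fun l => hτ _) (fun l => I (l + 1)) fun l => hI _
      have h₃ := (h₀ (τ 0) (I 0) (hI 0).2 (hI 0).1).1
      refine ⟨fun j hj => ?_, fun i j hij hj => ?_⟩
      · rcases j with _ | j
        · simp
        · have hj' := h₁ j (by omega)
          rw [prod_range_succ', mul_comm]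
          refine mem_insert_of_mem (mem_filter.2 ⟨mem_image.2 ⟨(τ 0, I 0, _), ?_, rfl⟩,
            (h₃ _ hj' (hτ 0)).2⟩)
          simp only [mem_product, mem_univ, mem_powerset, true_and]
          exact ⟨(hI 0).2, hj'⟩
      · obtain ⟨j, rfl⟩ : ∃ j', j = j' + 1 := ⟨j - 1, by omega⟩
        rcases i with _ | i
        · rw [← range_eq_Ico, prod_range_succ', mul_comm]
          exact (h₃ _ (h₁ j (by omega)) (hτ 0)).1
        · rw [← prod_Ico_add']
          exact h₂ i j (by omega) (by omega)

/-- Every finite coloring of `ℚ` admits nonzero `x`, `y` with `x`, `y`, `x * y` and all `x + i * y`,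
`i ≤ k`, of the same color. -/
theorem exists_monochromatic_of_finite {κ : Type} [Finite κ] (k : ℕ) (c : ℚ → κ) :
    ∃ x y : ℚ, x ≠ 0 ∧ y ≠ 0 ∧ c y = c x ∧ c (x * y) = c x ∧
      ∀ i : ℕ, i ≤ k → c (x + (i : ℚ) * y) = c x := by
  classical
  have := Fintype.ofFinite κ
  obtain ⟨U, p, hp, hmul, hc, F, hF⟩ := exists_ultrafilter_family fun u : ℚˣ => c u
  choose φ hφF hφU using hF
  let M := Fintype.card (κ × F)
  have hM : 0 < M := Fintype.card_pos_iff.2 ⟨c 0, φ 1, hφF 1⟩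
  obtain ⟨Ω, _, N, I, hI, H⟩ :=
    exists_recurrent_translate (Θ := Fin M → κ) (κ := Prop × κ) F (k + 1) M
  obtain ⟨e, b, heb, hb⟩ := exists_blocks _ U p hp hmul hc N M
  let e' : ℕ → (Fin M → κ) → ℕ → ℚ := fun l θ q => if h : l < M then e l (θ ⟨l, h⟩) q else 1
  have he' : ∀ l θ (h : l < M), e' l θ = e l (θ ⟨l, h⟩) := fun l θ h => by
    ext q
    exact dif_pos h
  obtain ⟨w, hw⟩ := H e' fun l θ J hJ hJN => by
    by_cases h : l < M
    · rw [he' l θ h, ← heb l _ J hJN hJ]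
      exact Units.ne_zero _
    · simpa [e', h] using hJ.ne_empty
  obtain ⟨ω, hω⟩ := hw (fun x => (x = 0, c x)) 0
  simp only [zero_add, Prod.mk.injEq] at hω
  have hbs : ∀ (τ : ℕ → κ) (l), l < M →
      blockSum e' (I ω) (fun i => τ i) l = b l (τ l) (I ω l) := fun τ l hl => by
    rw [heb l _ _ (hI ω l).2 (hI ω l).1]
    exact sum_congr rfl fun q _ => congrFun (he' l (fun i => τ i) hl) q
  have hx : w ω ≠ 0 := by
    intro h0
    have h := (hω (fun _ => c 0) 0 1 one_pos hM (φ 1) (hφF 1) 1 (by omega)).1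
    simp [h0, hbs (fun _ => c 0) 0 hM] at h
  let next : ℕ → ℚˣ → ℚˣ := fun l u => u * b l (c ↑(u * φ u)) (I ω l)
  let g : ℕ → ℚˣ := fun l => Nat.rec (Units.mk0 (w ω) hx) next l
  let τ : ℕ → κ := fun l => c ↑(g l * φ (g l))
  have hg : ∀ i, g i = Units.mk0 (w ω) hx * ∏ l ∈ range i, b l (τ l) (I ω l) := by
    intro i
    induction i with
    | zero => simp [g]
    | succ i ih =>
      rw [prod_range_succ, ← mul_assoc, ← ih]
  obtain ⟨i, j, hij, hj, hτ, hφ⟩ :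
      ∃ i j, i < j ∧ j ≤ M ∧ τ i = τ j ∧ φ (g i) = φ (g j) := by
    obtain ⟨i, j, hne, h⟩ := Fintype.exists_ne_map_eq_of_card_lt
      (fun i : Fin (M + 1) => ((τ i, ⟨φ (g i), hφF _⟩) : κ × F)) (by simp [M])
    simp only [Prod.mk.injEq, Subtype.mk.injEq] at h
    rcases lt_or_gt_of_ne hne with hlt | hlt
    · exact ⟨i, j, hlt, by omega, h.1, h.2⟩
    · exact ⟨j, i, hlt, by omega, h.1.symm, h.2.symm⟩
  set Y : ℚˣ := ∏ l ∈ Ico i j, b l (τ l) (I ω l) with hY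
  have hgj : g j = g i * Y := by
    rw [hg, hg, mul_assoc, prod_range_mul_prod_Ico _ hij.le]
  refine ⟨↑(g i * φ (g i)), Y, Units.ne_zero _, Units.ne_zero _,
    hb τ (fun l => hφU _) (I ω) (hI ω) i j hij hj, ?_, fun s hs => ?_⟩
  · rw [← Units.val_mul, mul_right_comm, ← hgj]
    exact (congrArg (fun f => c ↑(g j * f)) hφ).trans hτ.symm
  · have h := (hω (fun l => τ l) i j hij hj (φ (g i)) (hφF _) s (by omega)).2
    rw [prod_congr rfl fun l hl => hbs τ l ((mem_range.1 hl).trans (hij.trans_le hj)),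
      prod_congr rfl fun l hl => hbs τ l ((mem_Ico.1 hl).2.trans_le hj), ← Units.coe_prod,
      ← Units.coe_prod, ← hY, ← mul_assoc] at h
    have hgi := congrArg Units.val (hg i)
    rw [Units.val_mul, Units.val_mk0] at hgi
    rw [← hgi, ← Units.val_mul] at h
    exact h

end RecurrentTranslates

/-- For every `k` and any finite coloring of the rationals, there exist nonzero
rationals `x` and `y` such that `{x, y, x*y} ∪ {x + i*y : i = 1,…,k}` is
monochromatic. -/
theorem hindman_quadruple_AP (k n : ℕ) (c : ℚ → Fin n) :
    ∃ x y : ℚ, x ≠ 0 ∧ y ≠ 0 ∧ c y = c x ∧ c (x * y) = c x ∧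
      ∀ i : ℕ, 1 ≤ i → i ≤ k → c (x + (i : ℚ) * y) = c x := by
  obtain ⟨x, y, hx, hy, hxy, hmul, hadd⟩ := exists_monochromatic_of_finite k c
  exact ⟨x, y, hx, hy, hxy, hmul, fun i _ => hadd i⟩
end
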